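/- arXiv:1607.00700 — 9 statements merged into one kernel-verified Lean document; each statement's English description precedes it below -/
import Mathlib

section
/- Let p be an odd prime and let α be a p-integer. Then C(αp−1, p−1) ≡ 1 − α(α−1)(α²−α−1)·p·(∑_{k=1}^{p−1} 1/k) + α²(α−1)²·p²·(∑_{1≤i<j≤p−1} 1/(ij)) (mod p^m), where m = 7 if p ≠ 7 and m = 6 if p = 7. -/
open Finset

/-- A rational number is a `p`-integer if its `p`-adic valuation is nonnegative
(equivalently, its denominator is not divisible by `p`). -/
def IsPInteger (p : ℕ) (x : ℚ) : Prop := 0 ≤ padicValRat p x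

/-- `a ≡ b (mod p^m)` for `p`-integers: `(a - b) / p^m` is a `p`-integer. -/
def PModEq (p m : ℕ) (a b : ℚ) : Prop := IsPInteger p ((a - b) / (p : ℚ) ^ m)

/-- The generalized binomial coefficient `C(αp - 1, p - 1) = (∏_{k=1}^{p-1} (αp - k)) / (p-1)!`. -/
def genBinom (p : ℕ) (α : ℚ) : ℚ :=
  (∏ k ∈ Finset.Icc 1 (p - 1), (α * p - k)) / (Nat.factorial (p - 1) : ℚ)

open Polynomial in
/-- Pairing the roots `k` and `2 n + 1 - k` writes the product as a polynomial in
`X ^ 2 - (2 n + 1) X`. -/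
theorem prod_X_sub_natCast_eq_comp (n : ℕ) :
    ∏ k ∈ Icc 1 (2 * n), (X - C (k : ℤ)) =
      (∏ k ∈ range n, (X + C (((k : ℤ) + 1) * (2 * n - k)))).comp
        (X ^ 2 - C (2 * (n : ℤ) + 1) * X) := by
  have hshift : ∏ k ∈ Icc 1 (2 * n), (X - C (k : ℤ)) =
      ∏ k ∈ range (n + n), (X - C ((k : ℤ) + 1)) := by
    rw [← two_mul]
    exact prod_nbij' (· - 1) (· + 1) (by simp; omega) (by simp) (by simp; omega) (by simp)
      fun k hk ↦ by rw [← Nat.cast_add_one, Nat.sub_add_cancel (mem_Icc.1 hk).1]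
  rw [hshift, prod_range_add, ← prod_range_reflect (fun k ↦ X - C (((n + k : ℕ) : ℤ) + 1)),
    ← prod_mul_distrib, Polynomial.prod_comp]
  refine prod_congr rfl fun k hk ↦ ?_
  have hk : k + 1 ≤ n := mem_range.1 hk
  have hcast : ((n + (n - 1 - k) : ℕ) : ℤ) = 2 * n - 1 - k := by omega
  rw [hcast]
  simp only [add_comp, X_comp, C_comp]
  simp only [map_add, map_mul, map_sub, map_one]
  ring

open Polynomial in
theorem ZMod.prod_X_sub_natCast_eq_X_pow_sub_one (p : ℕ) [Fact p.Prime] :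
    ∏ k ∈ Icc 1 (p - 1), (X - C (k : ZMod p)) = X ^ (p - 1) - 1 := by
  have hp : 1 < p := (Fact.out : p.Prime).one_lt
  have hdeg : (∏ k ∈ Icc 1 (p - 1), (X - C (k : ZMod p))).degree = ((p - 1 : ℕ) : WithBot ℕ) := by
    simp only [degree_prod, degree_X_sub_C, sum_const, Nat.card_Icc, Nat.add_sub_cancel,
      nsmul_eq_mul, mul_one]
  have hdegX : (X ^ (p - 1) - 1 : (ZMod p)[X]).degree = ((p - 1 : ℕ) : WithBot ℕ) := by
    simpa using degree_X_pow_sub_C (R := ZMod p) (by omega : 0 < p - 1) 1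
  have hne : ∀ k ∈ Icc 1 (p - 1), (k : ZMod p) ≠ 0 := fun k hk h ↦ by
    rw [mem_Icc] at hk
    have := Nat.le_of_dvd (by omega) ((ZMod.natCast_eq_zero_iff k p).1 h)
    omega
  refine eq_of_degree_sub_lt_of_eval_index_eq (v := fun k : ℕ ↦ (k : ZMod p)) (Icc 1 (p - 1))
    ?_ ?_ ?_
  · intro a ha b hb hab
    simp only [coe_Icc, Set.mem_Icc] at ha hb
    have := (ZMod.natCast_eq_natCast_iff' a b p).1 hab
    rwa [Nat.mod_eq_of_lt (by omega), Nat.mod_eq_of_lt (by omega)] at this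
  · have hlt := degree_sub_lt_left (hdeg.trans hdegX.symm)
      (prod_ne_zero_iff.2 fun k _ ↦ X_sub_C_ne_zero _) (by
        rw [(monic_prod_of_monic _ _ fun k _ ↦ monic_X_sub_C _).leadingCoeff,
          ← C_1, (monic_X_pow_sub_C (1 : ZMod p) (by omega : p - 1 ≠ 0)).leadingCoeff])
    simpa only [Nat.card_Icc, Nat.add_sub_cancel, hdeg] using hlt
  · intro k hk
    rw [eval_prod, prod_eq_zero hk (by simp)]
    simp [ZMod.pow_card_sub_one_eq_one (hne k hk)]

open Polynomial in
theorem coeff_prod_one_sub_C_mul_X {R : Type*} [CommRing R] (f : ℕ → R) (n : ℕ) :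
    (∏ k ∈ Icc 1 n, (1 - C (f k) * X)).coeff 0 = 1 ∧
    (∏ k ∈ Icc 1 n, (1 - C (f k) * X)).coeff 1 = -∑ k ∈ Icc 1 n, f k ∧
    (∏ k ∈ Icc 1 n, (1 - C (f k) * X)).coeff 2 =
      ∑ i ∈ Icc 1 n, ∑ j ∈ Icc (i + 1) n, f i * f j := by
  induction n with
  | zero => simp [coeff_one]
  | succ n ih =>
    obtain ⟨h0, h1, h2⟩ := ih
    have hdouble : ∑ i ∈ Icc 1 (n + 1), ∑ j ∈ Icc (i + 1) (n + 1), f i * f j =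
        ∑ i ∈ Icc 1 n, ∑ j ∈ Icc (i + 1) n, f i * f j + (∑ i ∈ Icc 1 n, f i) * f (n + 1) := by
      rw [sum_Icc_succ_top (by omega), Icc_eq_empty (by omega : ¬ n + 1 + 1 ≤ n + 1), sum_empty,
        add_zero, sum_mul, ← sum_add_distrib]
      refine sum_congr rfl fun i hi ↦ ?_
      rw [mem_Icc] at hi
      rw [sum_Icc_succ_top (by omega)]
    rw [hdouble, prod_Icc_succ_top (by omega), sum_Icc_succ_top (by omega), mul_sub, mul_one,
      mul_left_comm]
    refine ⟨?_, ?_, ?_⟩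
    · simp [h0]
    · rw [coeff_sub, coeff_C_mul, coeff_mul_X, h0, h1]
      ring
    · rw [coeff_sub, coeff_C_mul, coeff_mul_X, h1, h2]
      ring

open Polynomial in
theorem eq_coeff_add_X_pow_four_mul {R : Type*} [CommRing R] (G : R[X]) :
    G = C (G.coeff 0) + C (G.coeff 1) * X + C (G.coeff 2) * X ^ 2 + C (G.coeff 3) * X ^ 3 +
      X ^ 4 * G.divX.divX.divX.divX := by
  have h0 := divX_mul_X_add G
  have h1 := divX_mul_X_add G.divX
  have h2 := divX_mul_X_add G.divX.divX
  have h3 := divX_mul_X_add G.divX.divX.divX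
  simp only [coeff_divX, zero_add] at h1 h2 h3
  norm_num at h1 h2 h3
  linear_combination -h0 - X * h1 - X ^ 2 * h2 - X ^ 3 * h3

open Polynomial in
theorem coeff_comp_X_sq_sub_C_mul_X {R : Type*} [CommRing R] (G : R[X]) (a : R) :
    (G.comp (X ^ 2 - C a * X)).coeff 0 = G.coeff 0 ∧
    (G.comp (X ^ 2 - C a * X)).coeff 1 = -a * G.coeff 1 ∧
    (G.comp (X ^ 2 - C a * X)).coeff 2 = G.coeff 1 + a ^ 2 * G.coeff 2 := by
  obtain ⟨S, hS⟩ : ∃ S : R[X], G.comp (X ^ 2 - C a * X) = C (G.coeff 0) +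
      C (-a * G.coeff 1) * X + C (G.coeff 1 + a ^ 2 * G.coeff 2) * X ^ 2 + S * X ^ 3 := by
    refine ⟨C (G.coeff 2) * (X - 2 * C a) + C (G.coeff 3) * (X - C a) ^ 3 +
      X * (X - C a) ^ 4 * G.divX.divX.divX.divX.comp (X ^ 2 - C a * X), ?_⟩
    conv_lhs => rw [eq_coeff_add_X_pow_four_mul G]
    simp only [add_comp, mul_comp, C_comp, X_comp, pow_comp, map_add, map_mul, map_neg, map_pow]
    ring
  rw [hS]
  simp only [coeff_add, coeff_C_mul, coeff_mul_X_pow', coeff_X, coeff_C]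
  norm_num

/-- The subring of `ℚ` of rationals that are `p`-integral. -/
noncomputable def pIntegerSubring (p : ℕ) [Fact p.Prime] : Subring ℚ :=
  (PadicInt.subring p).comap (Rat.castHom ℚ_[p])

theorem mem_pIntegerSubring_iff (p : ℕ) [Fact p.Prime] (x : ℚ) :
    x ∈ pIntegerSubring p ↔ IsPInteger p x := by
  change ‖(x : ℚ_[p])‖ ≤ 1 ↔ _
  rw [Padic.norm_le_one_iff_val_nonneg, Padic.valuation_ratCast, IsPInteger]

theorem inv_natCast_mem_pIntegerSubring {p : ℕ} [hp : Fact p.Prime] {N : ℕ} (hN : ¬ p ∣ N) :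
    (N : ℚ)⁻¹ ∈ pIntegerSubring p := by
  rw [mem_pIntegerSubring_iff, IsPInteger, padicValRat.inv, padicValRat.of_nat,
    padicValNat.eq_zero_of_not_dvd hN]
  simp

open Polynomial in
theorem natCast_dvd_coeff_three_of_comp {p : ℕ} [Fact p.Prime] (h7 : p ≠ 7) {G : ℤ[X]}
    (hG : ∏ k ∈ Icc 1 (p - 1), (X - C (k : ℤ)) = G.comp (X ^ 2 - C (p : ℤ) * X)) :
    (p : ℤ) ∣ G.coeff 3 := by
  have h := congrArg (Polynomial.map (Int.castRingHom (ZMod p))) hG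
  rw [Polynomial.map_prod, Polynomial.map_comp] at h
  simp only [Polynomial.map_sub, Polynomial.map_mul, Polynomial.map_pow, map_X, map_C,
    Int.coe_castRingHom, Int.cast_natCast, CharP.cast_eq_zero, C_0, zero_mul, sub_zero] at h
  rw [ZMod.prod_X_sub_natCast_eq_X_pow_sub_one, ← expand_eq_comp_X_pow] at h
  have h6 := congrArg (coeff · (3 * 2)) h
  simp only [coeff_expand_mul two_pos, coeff_map, coeff_sub, coeff_X_pow, coeff_one] at h6
  rw [if_neg (by omega), if_neg (by omega), sub_zero] at h6
  exact (ZMod.intCast_zmod_eq_zero_iff_dvd _ p).1 h6.symm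

open Polynomial in
theorem generalized_wolstenholme_morley (p : ℕ) (hp : p.Prime) (hodd : Odd p)
    (α : ℚ) (hα : IsPInteger p α) :
    PModEq p (if p = 7 then 6 else 7) (genBinom p α)
      (1 - α * (α - 1) * (α ^ 2 - α - 1) * p * (∑ k ∈ Finset.Icc 1 (p - 1), (1 : ℚ) / k)
        + α ^ 2 * (α - 1) ^ 2 * p ^ 2 *
          (∑ i ∈ Finset.Icc 1 (p - 1), ∑ j ∈ Finset.Icc (i + 1) (p - 1),
            (1 : ℚ) / (i * j))) := by
  have : Fact p.Prime := ⟨hp⟩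
  have hp0 : (p : ℚ) ≠ 0 := Nat.cast_ne_zero.2 hp.ne_zero
  obtain ⟨G, hG⟩ : ∃ G : ℤ[X],
      ∏ k ∈ Icc 1 (p - 1), (X - C (k : ℤ)) = G.comp (X ^ 2 - C (p : ℤ) * X) := by
    obtain ⟨n, rfl⟩ := hodd
    exact ⟨_, by simpa using prod_X_sub_natCast_eq_comp n⟩
  set N : ℚ := ((p - 1).factorial : ℚ) with hN
  have hN0 : N ≠ 0 := Nat.cast_ne_zero.2 (Nat.factorial_ne_zero _)
  have hNinv : N⁻¹ ∈ pIntegerSubring p :=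
    inv_natCast_mem_pIntegerSubring fun h ↦ by
      have := (hp.dvd_factorial).1 h
      have := hp.pos
      omega
  set g : ℚ[X] := G.map (Int.castRingHom ℚ) with hg
  have hFg : ∏ k ∈ Icc 1 (p - 1), (X - C (k : ℚ)) = g.comp (X ^ 2 - C (p : ℚ) * X) := by
    simpa [Polynomial.map_prod, Polynomial.map_comp] using
      congrArg (Polynomial.map (Int.castRingHom ℚ)) hG
  have hscale : ∏ k ∈ Icc 1 (p - 1), (X - C (k : ℚ)) =
      C N * ∏ k ∈ Icc 1 (p - 1), (1 - C ((1 : ℚ) / k) * X) := by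
    have hprod : C N = ∏ k ∈ Icc 1 (p - 1), -C (k : ℚ) := by
      have heven : Even (p - 1) := Nat.Odd.sub_odd hodd odd_one
      rw [prod_neg, Nat.card_Icc, Nat.add_sub_cancel, heven.neg_one_pow, one_mul, hN,
        show (p - 1).factorial = ∏ k ∈ Icc 1 (p - 1), k from
          (prod_Ico_id_eq_factorial (p - 1)).symm,
        Nat.cast_prod, map_prod]
    rw [hprod, ← prod_mul_distrib]
    refine prod_congr rfl fun k hk ↦ ?_
    have hk0 : (k : ℚ) ≠ 0 := Nat.cast_ne_zero.2 (by have := mem_Icc.1 hk; omega)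
    have hC : C (k : ℚ) * C ((1 : ℚ) / k) = 1 := by
      rw [← C_mul, mul_one_div_cancel hk0, C_1]
    linear_combination -X * hC
  obtain ⟨he0, he1, he2⟩ := coeff_prod_one_sub_C_mul_X (fun k : ℕ ↦ (1 : ℚ) / k) (p - 1)
  obtain ⟨hc0, hc1, hc2⟩ := coeff_comp_X_sq_sub_C_mul_X g (p : ℚ)
  rw [← hFg, hscale, coeff_C_mul] at hc0 hc1 hc2
  rw [he0] at hc0
  rw [he1] at hc1
  rw [he2] at hc2
  simp only [one_div_mul_one_div] at hc2
  set E₁ := ∑ k ∈ Icc 1 (p - 1), (1 : ℚ) / k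
  set E₂ := ∑ i ∈ Icc 1 (p - 1), ∑ j ∈ Icc (i + 1) (p - 1), (1 : ℚ) / (i * j)
  have hgen : genBinom p α = N⁻¹ * g.eval (p ^ 2 * (α * (α - 1))) := by
    have := congrArg (eval (α * p)) hFg
    rw [eval_prod, eval_comp] at this
    simp only [eval_sub, eval_X, eval_C, eval_pow, eval_mul] at this
    rw [genBinom, this, div_eq_inv_mul]
    congr 2
    ring
  set t := α * (α - 1) with ht
  set h := g.divX.divX.divX.divX with hh
  have heval : g.eval (p ^ 2 * t) = g.coeff 0 + g.coeff 1 * (p ^ 2 * t) +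
      g.coeff 2 * (p ^ 2 * t) ^ 2 + g.coeff 3 * (p ^ 2 * t) ^ 3 +
      (p ^ 2 * t) ^ 4 * h.eval (p ^ 2 * t) := by
    conv_lhs => rw [eq_coeff_add_X_pow_four_mul g]
    simp [hh]
  have hdiff : genBinom p α - (1 - α * (α - 1) * (α ^ 2 - α - 1) * p * E₁ +
      α ^ 2 * (α - 1) ^ 2 * p ^ 2 * E₂) =
      N⁻¹ * (p ^ 6 * (g.coeff 3 * t ^ 3 + p ^ 2 * t ^ 4 * h.eval (p ^ 2 * t))) := by
    rw [hgen, heval]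
    field_simp
    rw [ht]
    linear_combination (-1 : ℚ) * hc0 - α * (α - 1) * (α ^ 2 - α - 1) * p * hc1 -
      α ^ 2 * (α - 1) ^ 2 * p ^ 2 * hc2
  have hαmem : α ∈ pIntegerSubring p := (mem_pIntegerSubring_iff p α).2 hα
  have htmem : t ∈ pIntegerSubring p := mul_mem hαmem (sub_mem hαmem (one_mem _))
  have hpmem : (p : ℚ) ∈ pIntegerSubring p := natCast_mem _ p
  have hcoeff (n : ℕ) : g.coeff n = (G.coeff n : ℚ) := by simp [hg]
  have hhmem : h.eval (p ^ 2 * t) ∈ pIntegerSubring p := by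
    rw [eval_eq_sum_range]
    refine sum_mem fun i _ ↦ mul_mem ?_ (pow_mem (mul_mem (pow_mem hpmem _) htmem) _)
    simp only [hh, coeff_divX, hcoeff]
    exact intCast_mem _ _
  rw [PModEq, hdiff, ← mem_pIntegerSubring_iff]
  split_ifs with h7
  · rw [mul_div_assoc, mul_div_cancel_left₀ _ (pow_ne_zero 6 hp0), hcoeff]
    exact mul_mem hNinv (add_mem (mul_mem (intCast_mem _ _) (pow_mem htmem _))
      (mul_mem (mul_mem (pow_mem hpmem _) (pow_mem htmem _)) hhmem))
  · obtain ⟨c, hc⟩ := natCast_dvd_coeff_three_of_comp h7 hG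
    have hfactor : (p : ℚ) ^ 6 * (g.coeff 3 * t ^ 3 + p ^ 2 * t ^ 4 * h.eval (p ^ 2 * t)) =
        p ^ 7 * (c * t ^ 3 + p * t ^ 4 * h.eval (p ^ 2 * t)) := by
      rw [hcoeff, hc]
      push_cast
      ring
    rw [mul_div_assoc, hfactor, mul_div_cancel_left₀ _ (pow_ne_zero 7 hp0)]
    exact mul_mem hNinv (add_mem (mul_mem (intCast_mem _ _) (pow_mem htmem _))
      (mul_mem (mul_mem hpmem (pow_mem htmem _)) hhmem))
end

section
/- Let p be an odd prime. Then the binomial coefficient C(2p−1, p−1) satisfies C(2p−1, p−1) ≡ 1 − 2p·(∑_{k=1}^{p−1} 1/k) + 4p²·(∑_{1≤i<j≤p−1} 1/(ij)) (mod p^m), where m = 7 if p ≠ 7 and m = 6 if p = 7. -/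
open Finset

open Polynomial in
/-- The first three coefficients of `∏ (1 - X / k)` are given by the elementary symmetric
functions of the `1 / k`. -/
lemma exists_prod_one_sub_inv_mul_X (n : ℕ) : ∃ R : ℚ[X],
    ∏ k ∈ Icc 1 n, (1 - C (1 / (k : ℚ)) * X) =
      1 - C (∑ k ∈ Icc 1 n, (1 : ℚ) / k) * X
        + C (∑ i ∈ Icc 1 n, ∑ j ∈ Icc (i + 1) n, (1 : ℚ) / (i * j)) * X ^ 2 + R * X ^ 3 := by
  induction n with
  | zero => exact ⟨0, by simp⟩
  | succ n ih =>
    obtain ⟨R, hR⟩ := ih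
    have he : ∑ i ∈ Icc 1 (n + 1), ∑ j ∈ Icc (i + 1) (n + 1), (1 : ℚ) / (i * j) =
        ∑ i ∈ Icc 1 n, ∑ j ∈ Icc (i + 1) n, (1 : ℚ) / (i * j)
          + (∑ k ∈ Icc 1 n, (1 : ℚ) / k) * (1 / ((n + 1 : ℕ) : ℚ)) := by
      rw [sum_Icc_succ_top (by omega), Icc_eq_empty (a := n + 1 + 1) (by omega), sum_empty,
        add_zero, sum_mul, ← sum_add_distrib]
      refine sum_congr rfl fun i hi => ?_
      rw [sum_Icc_succ_top (by have := (mem_Icc.mp hi).2; omega), one_div_mul_one_div]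
    refine ⟨R - R * C (1 / ((n + 1 : ℕ) : ℚ)) * X
      - C (1 / ((n + 1 : ℕ) : ℚ))
        * C (∑ i ∈ Icc 1 n, ∑ j ∈ Icc (i + 1) n, (1 : ℚ) / (i * j)), ?_⟩
    rw [prod_Icc_succ_top (by omega), hR, he, sum_Icc_succ_top (by omega)]
    simp only [C_add, C_mul]
    ring

open Polynomial in
lemma exists_eq_cubic_add_mul_X_pow_four {R : Type*} [CommRing R] (P : R[X]) :
    ∃ Q : R[X], P = C (P.coeff 0) + C (P.coeff 1) * X + C (P.coeff 2) * X ^ 2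
      + C (P.coeff 3) * X ^ 3 + Q * X ^ 4 := by
  refine ⟨P.divX.divX.divX.divX, ?_⟩
  have h0 := P.divX_mul_X_add
  have h1 := P.divX.divX_mul_X_add
  have h2 := P.divX.divX.divX_mul_X_add
  have h3 := P.divX.divX.divX.divX_mul_X_add
  simp only [coeff_divX, zero_add, Nat.reduceAdd] at h1 h2 h3
  linear_combination -h0 - X * h1 - X ^ 2 * h2 - X ^ 3 * h3

open Polynomial in
/-- The polynomial obtained from `∏ (X - k)`, `1 ≤ k ≤ 2 * h`, by pairing `k` with
`2 * h + 1 - k` and writing the result in the variable `X ^ 2 - (2 * h + 1) * X`. -/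
noncomputable def pairedPoly (h : ℕ) : ℤ[X] :=
  ∏ i ∈ range h, (X + C (((i : ℤ) + 1) * (2 * h - i)))

open Polynomial in
lemma pairedPoly_comp (h : ℕ) :
    (pairedPoly h).comp (X ^ 2 - C (2 * (h : ℤ) + 1) * X) =
      ∏ i ∈ range (2 * h), (X - C ((i : ℤ) + 1)) := by
  rw [two_mul h, prod_range_add, ← prod_range_reflect (fun i => X - C (((h + i : ℕ) : ℤ) + 1)),
    ← prod_mul_distrib, pairedPoly, Polynomial.prod_comp]
  refine prod_congr rfl fun i hi => ?_
  have hi' : i < h := mem_range.mp hi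
  have hc : ((h + (h - 1 - i) : ℕ) : ℤ) = 2 * h - 1 - i := by omega
  rw [hc]
  rw [add_comp, X_comp, C_comp]
  simp only [C_add, C_sub, C_mul, C_1]
  ring

open Polynomial in
lemma eval_pairedPoly (h : ℕ) :
    (pairedPoly h).eval (2 * (2 * (h : ℤ) + 1) ^ 2) =
      (2 * h).factorial * ((2 * (2 * h + 1) - 1).choose (2 * h) : ℤ) := by
  have hF := congrArg (eval (2 * (2 * (h : ℤ) + 1))) (pairedPoly_comp h)
  rw [eval_comp, eval_prod] at hF
  have hy : eval (2 * (2 * (h : ℤ) + 1)) (X ^ 2 - C (2 * (h : ℤ) + 1) * X) =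
      2 * (2 * (h : ℤ) + 1) ^ 2 := by simp; ring
  rw [hy] at hF
  rw [hF, ← Nat.cast_mul, ← Nat.descFactorial_eq_factorial_mul_choose,
    Nat.descFactorial_eq_prod_range, Nat.cast_prod]
  refine prod_congr rfl fun i hi => ?_
  have := mem_range.mp hi
  simp only [eval_sub, eval_X, eval_C]
  omega

open Polynomial in
lemma prod_X_sub_C_eq_factorial_mul (h : ℕ) :
    (∏ i ∈ range (2 * h), (X - C ((i : ℚ) + 1)) : ℚ[X]) =
      C ((2 * h).factorial : ℚ) * ∏ k ∈ Icc 1 (2 * h), (1 - C (1 / (k : ℚ)) * X) := by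
  have hsign : ∏ i ∈ range (2 * h), (X - C ((i : ℚ) + 1)) =
      ∏ i ∈ range (2 * h), (-1) * (X - C ((i : ℚ) + 1)) := by
    rw [prod_mul_distrib, prod_const, card_range, pow_mul, neg_one_sq, one_pow, one_mul]
  have hr : ∀ n : ℕ, ∏ k ∈ Icc 1 n, (1 - C (1 / (k : ℚ)) * X) =
      ∏ i ∈ range n, (1 - C (1 / ((i + 1 : ℕ) : ℚ)) * X) := fun n => by
    induction n with
    | zero => simp
    | succ n ih => rw [prod_Icc_succ_top (by omega), prod_range_succ, ih]
  rw [hsign, hr, ← prod_range_add_one_eq_factorial, Nat.cast_prod, map_prod, ← prod_mul_distrib]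
  refine prod_congr rfl fun i _ => ?_
  have hi : (i : ℚ) + 1 ≠ 0 := by positivity
  have hC : C ((i : ℚ) + 1) * C (1 / ((i : ℚ) + 1)) = 1 := by
    rw [← C_mul, mul_one_div_cancel hi, C_1]
  rw [Nat.cast_add, Nat.cast_one]
  linear_combination X * hC

open Polynomial in
lemma pairedPoly_coeff (h : ℕ) :
    ((pairedPoly h).coeff 0 : ℚ) = (2 * h).factorial ∧
    (2 * (h : ℚ) + 1) * ((pairedPoly h).coeff 1 : ℚ) =
      (2 * h).factorial * ∑ k ∈ Icc 1 (2 * h), (1 : ℚ) / k ∧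
    ((pairedPoly h).coeff 1 : ℚ) + (2 * (h : ℚ) + 1) ^ 2 * ((pairedPoly h).coeff 2 : ℚ) =
      (2 * h).factorial *
        ∑ i ∈ Icc 1 (2 * h), ∑ j ∈ Icc (i + 1) (2 * h), (1 : ℚ) / (i * j) := by
  obtain ⟨R, hR⟩ := exists_prod_one_sub_inv_mul_X (2 * h)
  obtain ⟨Q, hQ⟩ := exists_eq_cubic_add_mul_X_pow_four (pairedPoly h)
  have hF := congrArg (map (Int.castRingHom ℚ)) (pairedPoly_comp h)
  rw [Polynomial.map_prod] at hF
  simp only [Polynomial.map_sub, map_X, map_C, Int.coe_castRingHom, Int.cast_add, Int.cast_natCast,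
    Int.cast_one] at hF
  rw [prod_X_sub_C_eq_factorial_mul, hR, hQ] at hF
  simp only [add_comp, mul_comp, C_comp, X_comp, pow_comp, Polynomial.map_add, Polynomial.map_mul,
    Polynomial.map_sub, Polynomial.map_pow, map_C, map_X, Int.coe_castRingHom, Int.cast_add, Int.cast_mul,
    Int.cast_natCast, Int.cast_one, Int.cast_ofNat] at hF
  generalize ((pairedPoly h).coeff 0 : ℚ) = c0 at *
  generalize ((pairedPoly h).coeff 1 : ℚ) = c1 at *
  generalize ((pairedPoly h).coeff 2 : ℚ) = c2 at *
  generalize ((pairedPoly h).coeff 3 : ℚ) = c3 at *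
  generalize (∑ k ∈ Icc 1 (2 * h), (1 : ℚ) / k) = H at *
  generalize (∑ i ∈ Icc 1 (2 * h), ∑ j ∈ Icc (i + 1) (2 * h), (1 : ℚ) / (i * j)) = E at *
  generalize ((2 * h).factorial : ℚ) = N at *
  generalize 2 * (h : ℚ) + 1 = p at *
  generalize map (Int.castRingHom ℚ) (Q.comp (X ^ 2 - C (2 * (h : ℤ) + 1) * X)) = S at *
  have key : C (c0 - N) + C (N * H - p * c1) * X + C (c1 + p ^ 2 * c2 - N * E) * X ^ 2 =
      (C N * R + C (2 * p * c2) - C c2 * X - C c3 * (X - C p) ^ 3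
        - S * (X - C p) ^ 4 * X) * X ^ 3 := by
    simp only [C_sub, C_add, C_mul, C_pow, C_ofNat] at hF ⊢
    linear_combination hF
  have k0 := congrArg (coeff · 0) key
  have k1 := congrArg (coeff · 1) key
  have k2 := congrArg (coeff · 2) key
  simp only [coeff_mul_X_pow', coeff_add, coeff_C_mul, coeff_X, coeff_C] at k0 k1 k2
  norm_num at k0 k1 k2
  exact ⟨by linarith, by linarith, by linarith⟩

open Polynomial in
lemma prod_range_X_sub_C_add_one (p : ℕ) [Fact p.Prime] :
    (∏ i ∈ range (p - 1), (X - C ((i : ZMod p) + 1))) = X ^ (p - 1) - 1 := by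
  have hp := Fact.out (p := p.Prime)
  have hp1 : p - 1 ≠ 0 := by have := hp.two_le; omega
  have hdeg : degree (1 : (ZMod p)[X]) < degree ((X : (ZMod p)[X]) ^ (p - 1)) := by
    rw [degree_one, degree_X_pow]
    exact_mod_cast Nat.pos_of_ne_zero hp1
  have hne : ∀ i ∈ range (p - 1), (i : ZMod p) + 1 ≠ 0 := fun i hi h0 => by
    have hdvd : p ∣ i + 1 := (ZMod.natCast_eq_zero_iff _ _).mp (by exact_mod_cast h0)
    have := Nat.le_of_dvd i.succ_pos hdvd
    have := mem_range.mp hi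
    omega
  change Lagrange.nodal (range (p - 1)) (fun i : ℕ => (i : ZMod p) + 1) = _
  apply eq_of_degree_le_of_eval_index_eq (v := fun i : ℕ => (i : ZMod p) + 1) (range (p - 1))
  · intro i hi j hj hij
    have hi' := mem_range.mp (mem_coe.mp hi)
    have hj' := mem_range.mp (mem_coe.mp hj)
    have h := (ZMod.natCast_eq_natCast_iff i j p).mp (add_right_cancel hij)
    exact Nat.ModEq.eq_of_lt_of_lt h (by omega) (by omega)
  · simp
  · rw [degree_sub_eq_left_of_degree_lt hdeg, Lagrange.degree_nodal, card_range, degree_X_pow]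
  · rw [Lagrange.nodal_monic, leadingCoeff_sub_of_degree_lt hdeg, monic_X_pow]
  · intro i hi
    rw [Lagrange.eval_nodal_at_node (v := fun i : ℕ => (i : ZMod p) + 1) hi]
    simp [ZMod.pow_card_sub_one_eq_one (hne i hi)]

open Polynomial in
lemma dvd_pairedPoly_coeff {h m : ℕ} (hp : (2 * h + 1).Prime) (hm : m ≠ 0) (hmh : m ≠ h) :
    ((2 * h + 1 : ℕ) : ℤ) ∣ (pairedPoly h).coeff m := by
  have : Fact (2 * h + 1).Prime := ⟨hp⟩
  have hF := congrArg (map (Int.castRingHom (ZMod (2 * h + 1)))) (pairedPoly_comp h)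
  have hzero : 2 * (h : ZMod (2 * h + 1)) + 1 = 0 := by
    exact_mod_cast ZMod.natCast_self (2 * h + 1)
  have hprod : (∏ i ∈ range (2 * h), (X - C ((i : ZMod (2 * h + 1)) + 1))) = X ^ (2 * h) - 1 := by
    simpa using prod_range_X_sub_C_add_one (2 * h + 1)
  rw [map_comp, Polynomial.map_prod] at hF
  simp only [Polynomial.map_sub, Polynomial.map_mul, Polynomial.map_pow, map_X, map_C, Int.coe_castRingHom,
    Int.cast_add, Int.cast_mul, Int.cast_natCast, Int.cast_one, Int.cast_ofNat, hzero, C_0,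
    zero_mul, sub_zero, hprod] at hF
  rw [← expand_eq_comp_X_pow] at hF
  have hc := congrArg (coeff · (m * 2)) hF
  simp only [coeff_expand_mul two_pos, coeff_map, coeff_sub, coeff_X_pow, coeff_one] at hc
  rw [if_neg (by omega), if_neg (by omega), sub_zero] at hc
  exact (ZMod.intCast_zmod_eq_zero_iff_dvd _ _).mp hc

lemma isPInteger_div_natCast {p n : ℕ} (hp : p.Prime) (hn : ¬ p ∣ n) (z : ℤ) :
    IsPInteger p ((z : ℚ) / n) := by
  have : Fact p.Prime := ⟨hp⟩
  rw [IsPInteger]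
  rcases eq_or_ne z 0 with rfl | hz
  · simp
  · have hn0 : n ≠ 0 := by rintro rfl; simp at hn
    rw [padicValRat.div (by exact_mod_cast hz) (by exact_mod_cast hn0), padicValRat.of_int,
      padicValRat.of_nat, padicValNat.eq_zero_of_not_dvd hn]
    simp

theorem mestrovic_generalized (p : ℕ) (hp : p.Prime) (hodd : Odd p) :
    PModEq p (if p = 7 then 6 else 7) ((Nat.choose (2 * p - 1) (p - 1) : ℚ))
      (1 - 2 * p * (∑ k ∈ Finset.Icc 1 (p - 1), (1 : ℚ) / k)
        + 4 * p ^ 2 *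
          (∑ i ∈ Finset.Icc 1 (p - 1), ∑ j ∈ Finset.Icc (i + 1) (p - 1),
            (1 : ℚ) / (i * j))) := by
  obtain ⟨h, rfl⟩ := hodd
  obtain ⟨h0, h1, h2⟩ := pairedPoly_coeff h
  obtain ⟨Q, hQ⟩ := exists_eq_cubic_add_mul_X_pow_four (pairedPoly h)
  have hE := congrArg (Polynomial.eval (2 * (2 * (h : ℤ) + 1) ^ 2)) hQ
  rw [eval_pairedPoly] at hE
  simp only [Polynomial.eval_add, Polynomial.eval_mul, Polynomial.eval_pow, Polynomial.eval_C,
    Polynomial.eval_X] at hE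
  have hndvd : ¬ (2 * h + 1) ∣ (2 * h).factorial := by
    rw [hp.dvd_factorial]; omega
  have hN : ((2 * h).factorial : ℚ) ≠ 0 := by exact_mod_cast Nat.factorial_ne_zero _
  have hp0 : (2 * (h : ℚ) + 1) ≠ 0 := by positivity
  obtain ⟨z, hz⟩ : ∃ z : ℤ, 8 * (2 * (h : ℤ) + 1) ^ 6 * (pairedPoly h).coeff 3
      + Q.eval (2 * (2 * (h : ℤ) + 1) ^ 2) * (2 * (2 * (h : ℤ) + 1) ^ 2) ^ 4
      = (2 * (h : ℤ) + 1) ^ (if 2 * h + 1 = 7 then 6 else 7) * z := by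
    split_ifs with h7
    · exact ⟨8 * (pairedPoly h).coeff 3
        + Q.eval (2 * (2 * (h : ℤ) + 1) ^ 2) * 16 * (2 * (h : ℤ) + 1) ^ 2, by ring⟩
    · obtain ⟨c, hc⟩ := dvd_pairedPoly_coeff (m := 3) hp (by omega) (by omega)
      push_cast at hc
      exact ⟨8 * c + Q.eval (2 * (2 * (h : ℤ) + 1) ^ 2) * 16 * (2 * (h : ℤ) + 1), by
        rw [hc]; ring⟩
  generalize (if 2 * h + 1 = 7 then 6 else 7) = m at hz ⊢
  rw [PModEq]
  convert isPInteger_div_natCast hp hndvd z using 1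
  rw [Nat.add_sub_cancel]
  qify at hE hz
  push_cast
  rw [div_eq_div_iff (pow_ne_zero _ hp0) hN]
  linear_combination hE + hz + h0 - 2 * (2 * (h : ℚ) + 1) * h1 + 4 * (2 * (h : ℚ) + 1) ^ 2 * h2
end

section
/- Let p be an odd prime. Then (−1)^{(p−1)/2}·C(p−1, (p−1)/2) ≡ 4^{p−1}·(1 − (5/16)·p·(∑_{k=1}^{p−1} 1/k) + (1/16)·p²·(∑_{1≤i<j≤p−1} 1/(ij))) (mod p^m), where m = 7 if p ≠ 7 and m = 6 if p = 7, and C(p−1, (p−1)/2) denotes the central binomial coefficient. -/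
open Finset

open Polynomial in
/-- Pairing the factors indexed by `k` and `2 * n + 1 - k`. -/
lemma prod_sub_X_eq_comp {R : Type*} [CommRing R] (n : ℕ) :
    ∏ k ∈ range (2 * n), (C ((k : R) + 1) - X) =
      (∏ k ∈ range n, (C (((k : R) + 1) * (2 * n - k)) - X)).comp
        (X * (C ((2 * n + 1 : ℕ) : R) - X)) := by
  rw [two_mul, prod_range_add, ← prod_range_reflect (fun k => C (((n + k : ℕ) : R) + 1) - X),
    ← prod_mul_distrib, Polynomial.prod_comp]
  refine prod_congr rfl fun k hk => ?_
  have hk : k + 1 ≤ n := mem_range.1 hk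
  rw [show n + (n - 1 - k) = 2 * n - (k + 1) by omega, Nat.cast_sub (by omega)]
  simp only [sub_comp, C_comp, X_comp]
  push_cast
  simp only [C_mul, C_add, C_sub, C_1, C_ofNat]
  ring

/-- The sum over pairs, adding one index at a time. -/
lemma sum_pairs_succ (N : ℕ) :
    (∑ i ∈ Icc 1 (N + 1), ∑ j ∈ Icc (i + 1) (N + 1), (1 : ℚ) / (i * j)) =
      (∑ i ∈ Icc 1 N, ∑ j ∈ Icc (i + 1) N, (1 : ℚ) / (i * j)) +
        (∑ i ∈ Icc 1 N, (1 : ℚ) / i) * (1 / (N + 1)) := by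
  rw [sum_Icc_succ_top (by omega), Icc_eq_empty (a := N + 1 + 1) (by omega), sum_empty, add_zero,
    sum_mul, ← sum_add_distrib]
  refine sum_congr rfl fun i hi => ?_
  rw [sum_Icc_succ_top (by have := (mem_Icc.1 hi).2; omega)]
  push_cast
  rw [one_div_mul_one_div]

open Polynomial in
/-- The three lowest coefficients of `(1 - X) * (2 - X) * ⋯ * (N - X)`. -/
lemma exists_prod_sub_X_eq (N : ℕ) :
    ∃ Q : ℚ[X], ∏ k ∈ range N, (C ((k : ℚ) + 1) - X) =
      C (N.factorial : ℚ) * (1 - C (∑ k ∈ Icc 1 N, (1 : ℚ) / k) * X +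
        C (∑ i ∈ Icc 1 N, ∑ j ∈ Icc (i + 1) N, (1 : ℚ) / (i * j)) * X ^ 2) + X ^ 3 * Q := by
  induction N with
  | zero => exact ⟨0, by simp⟩
  | succ N ih =>
    obtain ⟨Q, hQ⟩ := ih
    rw [prod_range_succ, hQ, sum_pairs_succ, sum_Icc_succ_top (by omega), Nat.factorial_succ]
    set H := ∑ k ∈ Icc 1 N, (1 : ℚ) / k
    set E := ∑ i ∈ Icc 1 N, ∑ j ∈ Icc (i + 1) N, (1 : ℚ) / (i * j)
    have h : (C ((N : ℚ) + 1) : ℚ[X]) * C (1 / ((N : ℚ) + 1)) = 1 := by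
      rw [← C_mul, mul_one_div_cancel (by positivity), C_1]
    refine ⟨Q * (C ((N : ℚ) + 1) - X) - C (N.factorial : ℚ) * C E, ?_⟩
    push_cast
    simp only [C_mul, C_add] at h ⊢
    linear_combination (C (N.factorial : ℚ)) * (X - C H * X ^ 2) * h

/-- The central binomial coefficient as a product symmetric around `0`. -/
lemma four_pow_mul_prod_eq (n : ℕ) :
    (4 : ℚ) ^ n * ∏ k ∈ range (2 * n), (2 * ((k : ℚ) + 1) - (2 * n + 1)) =
      (-1) ^ n * n.centralBinom * (2 * n).factorial := by
  induction n with
  | zero => simp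
  | succ n ih =>
    have hc : ((n : ℚ) + 1) * (n + 1).centralBinom = 2 * (2 * n + 1) * n.centralBinom := by
      exact_mod_cast n.succ_mul_centralBinom_succ
    rw [show 2 * (n + 1) = 2 * n + 1 + 1 by ring, prod_range_succ, prod_range_succ',
      Nat.factorial_succ, Nat.factorial_succ]
    have h : ∀ k : ℕ, (2 * (((k + 1 : ℕ) : ℚ) + 1) - (2 * ((n + 1 : ℕ) : ℚ) + 1)) =
        2 * ((k : ℚ) + 1) - (2 * n + 1) := fun k => by push_cast; ring
    simp only [h]
    push_cast
    linear_combination (-4 * (2 * (n : ℚ) + 1) ^ 2) * ih +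
      ((-1) ^ n * 2 * (2 * (n : ℚ) + 1) * (2 * n).factorial) * hc

open Polynomial in
/-- The nonzero residues modulo `p` are the roots of `X ^ (p - 1) - 1`. -/
lemma ZMod.prod_sub_X_eq (n : ℕ) [Fact (2 * n + 1).Prime] :
    ∏ k ∈ range (2 * n), (C ((k : ZMod (2 * n + 1)) + 1) - X) = X ^ (2 * n) - 1 := by
  have hneg : ∏ k ∈ range (2 * n), (C ((k : ZMod (2 * n + 1)) + 1) - X) =
      ∏ k ∈ range (2 * n), (X - C ((k : ZMod (2 * n + 1)) + 1)) := by
    refine (prod_congr rfl fun (k : ℕ) _ => (neg_sub X (C ((k : ZMod (2 * n + 1)) + 1))).symm).trans ?_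
    rw [prod_neg]
    simp
  rw [hneg]
  have hcast : ∀ k ∈ range (2 * n), ((k : ZMod (2 * n + 1)) + 1) ≠ 0 := fun k hk h => by
    have hk := mem_range.1 hk
    have h' : ((k + 1 : ℕ) : ZMod (2 * n + 1)) = 0 := by exact_mod_cast h
    have := Nat.le_of_dvd k.succ_pos ((ZMod.natCast_eq_zero_iff _ _).1 h')
    omega
  have hpos : 0 < 2 * n := by
    have := (Fact.out : (2 * n + 1).Prime).one_lt
    omega
  refine eq_of_degree_sub_lt_of_eval_index_eq (range (2 * n))
    (v := fun k : ℕ => (k : ZMod (2 * n + 1)) + 1) ?_ ?_ ?_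
  · intro a ha b hb hab
    have ha := mem_range.1 ha
    have hb := mem_range.1 hb
    have h := (ZMod.natCast_eq_natCast_iff' a b (2 * n + 1)).1 (add_right_cancel hab)
    rwa [Nat.mod_eq_of_lt (by omega), Nat.mod_eq_of_lt (by omega)] at h
  · have hX : (X ^ (2 * n) - 1 : (ZMod (2 * n + 1))[X]).Monic := by
      simpa using monic_X_pow_sub_C (1 : ZMod (2 * n + 1)) hpos.ne'
    have hP := monic_prod_X_sub_C (fun k : ℕ => (k : ZMod (2 * n + 1)) + 1) (range (2 * n))
    have hdP : (∏ k ∈ range (2 * n), (X - C ((k : ZMod (2 * n + 1)) + 1))).degree =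
        ((2 * n : ℕ) : WithBot ℕ) := by
      rw [degree_prod, sum_congr rfl fun k _ => degree_X_sub_C _]
      simp
    have hdX : (X ^ (2 * n) - 1 : (ZMod (2 * n + 1))[X]).degree = ((2 * n : ℕ) : WithBot ℕ) := by
      simpa using degree_X_pow_sub_C hpos (1 : ZMod (2 * n + 1))
    rw [card_range, ← hdP]
    exact degree_sub_lt_left (hdP.trans hdX.symm) hP.ne_zero (by rw [hP.leadingCoeff, hX.leadingCoeff])
  · intro k hk
    have h := ZMod.pow_card_sub_one_eq_one (hcast k hk)
    rw [eval_prod, prod_eq_zero hk (by simp)]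
    simpa using (sub_eq_zero.2 h).symm

open Polynomial in
lemma dvd_coeff_three (n : ℕ) (hp : (2 * n + 1).Prime) (hn : n ≠ 3) :
    ((2 * n + 1 : ℕ) : ℤ) ∣
      (∏ k ∈ range n, (C (((k : ℤ) + 1) * (2 * n - k)) - X)).coeff 3 := by
  have : Fact (2 * n + 1).Prime := ⟨hp⟩
  rw [← ZMod.intCast_zmod_eq_zero_iff_dvd]
  change Int.castRingHom _ _ = 0
  rw [← coeff_map]
  have hmap : (∏ k ∈ range n, (C (((k : ℤ) + 1) * (2 * n - k)) - X)).map
      (Int.castRingHom (ZMod (2 * n + 1))) =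
      ∏ k ∈ range n, (C (((k : ZMod (2 * n + 1)) + 1) * (2 * n - k)) - X) := by
    simp only [Polynomial.map_prod, Polynomial.map_sub, map_C, map_X]
    simp only [eq_intCast, Int.cast_mul, Int.cast_add, Int.cast_sub, Int.cast_natCast,
      Int.cast_one, Int.cast_ofNat]
  rw [hmap]
  have h := prod_sub_X_eq_comp (R := ZMod (2 * n + 1)) n
  rw [ZMod.prod_sub_X_eq, ZMod.natCast_self, C_0, zero_sub] at h
  set P := ∏ k ∈ range n, (C (((k : ZMod (2 * n + 1)) + 1) * (2 * n - k)) - X)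
  have hY : P.comp (X * -X) = expand _ 2 (P.comp (C (-1) * X)) := by
    rw [expand_eq_comp_X_pow, comp_assoc]
    congr 1
    simp [sq]
  have h6 := congrArg (fun Q => coeff Q (3 * 2)) h
  simp only [hY] at h6
  rw [coeff_expand_mul (by norm_num), comp_C_mul_X_coeff, coeff_sub, coeff_X_pow, coeff_one,
    if_neg (by omega), if_neg (by omega)] at h6
  simpa using h6

/-- The subring of `p`-integers of `ℚ`. -/
noncomputable def pIntegers (p : ℕ) [Fact p.Prime] : Subring ℚ :=
  (PadicInt.subring p).comap (Rat.castHom ℚ_[p])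

lemma isPInteger_of_mem {p : ℕ} [Fact p.Prime] {x : ℚ} (hx : x ∈ pIntegers p) :
    IsPInteger p x := by
  have h : ‖(x : ℚ_[p])‖ ≤ 1 := hx
  rwa [Padic.norm_le_one_iff_val_nonneg, Padic.valuation_ratCast] at h

lemma inv_natCast_mem_pIntegers {p : ℕ} [Fact p.Prime] {d : ℕ} (hd : p.Coprime d) :
    (d : ℚ)⁻¹ ∈ pIntegers p := by
  have h : ‖(d : ℚ_[p])‖ = 1 := Padic.norm_natCast_eq_one_iff.2 hd
  change ‖(((d : ℚ)⁻¹ : ℚ) : ℚ_[p])‖ ≤ 1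
  push_cast
  rw [norm_inv, h, inv_one]

open Polynomial in
lemma eval_map_intCast_mem (S : Subring ℚ) (R : ℤ[X]) {a : ℚ} (ha : a ∈ S) :
    (R.map (Int.castRingHom ℚ)).eval a ∈ S := by
  rw [eval_map, eval₂_eq_sum_range]
  exact sum_mem fun i _ => mul_mem (intCast_mem S _) (pow_mem ha i)

open Polynomial in
lemma eq_low_coeffs_add (P : ℤ[X]) :
    P = C (P.coeff 0) + C (P.coeff 1) * X + C (P.coeff 2) * X ^ 2 + C (P.coeff 3) * X ^ 3 +
      X ^ 4 * P.divX.divX.divX.divX := by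
  have h0 := divX_mul_X_add P
  have h1 := divX_mul_X_add P.divX
  have h2 := divX_mul_X_add P.divX.divX
  have h3 := divX_mul_X_add P.divX.divX.divX
  simp only [coeff_divX, zero_add, Nat.reduceAdd] at h1 h2 h3
  linear_combination -h0 - X * h1 - X ^ 2 * h2 - X ^ 3 * h3

open Polynomial in
/-- The error term in the congruence, in terms of the polynomial `∏ (k (p - k) - X)`. -/
lemma centralBinom_sub_eq (n : ℕ) :
    ∃ (b : ℤ) (R : ℤ[X]),
      b = (∏ k ∈ range n, (C (((k : ℤ) + 1) * (2 * n - k)) - X)).coeff 3 ∧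
      (-1 : ℚ) ^ n * n.centralBinom - 4 ^ (2 * n) *
        (1 - (5 / 16) * (2 * n + 1 : ℕ) * (∑ k ∈ Icc 1 (2 * n), (1 : ℚ) / k)
          + (1 / 16) * (2 * n + 1 : ℕ) ^ 2 *
            (∑ i ∈ Icc 1 (2 * n), ∑ j ∈ Icc (i + 1) (2 * n), (1 : ℚ) / (i * j))) =
      4 ^ (2 * n) * ((2 * n).factorial : ℚ)⁻¹ * (b * (2 * n + 1 : ℕ) ^ 6 * ((4 : ℕ) : ℚ)⁻¹ ^ 3 +
        (2 * n + 1 : ℕ) ^ 8 * ((4 : ℕ) : ℚ)⁻¹ ^ 4 *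
          (R.map (Int.castRingHom ℚ)).eval ((2 * n + 1 : ℕ) ^ 2 * ((4 : ℕ) : ℚ)⁻¹)) := by
  have hP := eq_low_coeffs_add (∏ k ∈ range n, (C (((k : ℤ) + 1) * (2 * n - k)) - X))
  refine ⟨_, (∏ k ∈ range n, (C (((k : ℤ) + 1) * (2 * n - k)) - X)).divX.divX.divX.divX,
    rfl, ?_⟩
  set P := ∏ k ∈ range n, (C (((k : ℤ) + 1) * (2 * n - k)) - X) with hPdef
  set R := P.divX.divX.divX.divX
  have hmap : P.map (Int.castRingHom ℚ) =
      ∏ k ∈ range n, (C (((k : ℚ) + 1) * (2 * n - k)) - X) := by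
    simp only [hPdef, Polynomial.map_prod, Polynomial.map_sub, map_C, map_X]
    simp only [eq_intCast, Int.cast_mul, Int.cast_add, Int.cast_sub, Int.cast_natCast,
      Int.cast_one, Int.cast_ofNat]
  have hcomp := prod_sub_X_eq_comp (R := ℚ) n
  rw [← hmap, hP] at hcomp
  obtain ⟨Q, hQ⟩ := exists_prod_sub_X_eq (2 * n)
  set H := ∑ k ∈ Icc 1 (2 * n), (1 : ℚ) / k
  set E := ∑ i ∈ Icc 1 (2 * n), ∑ j ∈ Icc (i + 1) (2 * n), (1 : ℚ) / (i * j)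
  set p : ℚ := ((2 * n + 1 : ℕ) : ℚ) with hp
  simp only [Polynomial.map_add, Polynomial.map_mul, Polynomial.map_pow, map_C, map_X,
    add_comp, mul_comp, pow_comp, C_comp, X_comp] at hcomp
  simp only [eq_intCast (Int.castRingHom ℚ)] at hcomp
  set W : ℚ := ((2 * n).factorial : ℚ)
  have hW0 : W ≠ 0 := by positivity
  generalize P.coeff 0 = b0 at *
  generalize P.coeff 1 = b1 at *
  generalize P.coeff 2 = b2 at *
  generalize P.coeff 3 = b3 at *
  have hlow := hQ.symm.trans hcomp
  obtain ⟨T, hT⟩ : ∃ T : ℚ[X], C W - C (W * H) * X + C (W * E) * X ^ 2 + X ^ 3 * T =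
      C (b0 : ℚ) + C (b1 * p) * X + C (b2 * p ^ 2 - b1) * X ^ 2 := by
    refine ⟨Q + C (b2 : ℚ) * (2 * C p - X) - C (b3 : ℚ) * (C p - X) ^ 3
      - X * (C p - X) ^ 4 * (R.map (Int.castRingHom ℚ)).comp (X * (C p - X)), ?_⟩
    simp only [C_mul, C_sub, C_pow]
    linear_combination hlow
  have c0 := congrArg (fun q => coeff q 0) hT
  have c1 := congrArg (fun q => coeff q 1) hT
  have c2 := congrArg (fun q => coeff q 2) hT
  simp only [coeff_add, coeff_sub, coeff_C_mul, coeff_X_pow_mul', coeff_X, coeff_C,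
    coeff_X_pow] at c0 c1 c2
  norm_num at c0 c1 c2
  have he := congrArg (eval (p / 2)) hcomp
  rw [eval_prod] at he
  have hcb := four_pow_mul_prod_eq n
  have hprod : ∏ k ∈ range (2 * n), (2 * ((k : ℚ) + 1) - (2 * n + 1)) =
      4 ^ n * ∏ k ∈ range (2 * n), (C ((k : ℚ) + 1) - X).eval (p / 2) := by
    rw [show (4 : ℚ) ^ n = ∏ k ∈ range (2 * n), 2 by
      rw [prod_const, card_range, pow_mul]; norm_num, ← prod_mul_distrib]
    refine prod_congr rfl fun k _ => ?_
    simp [hp]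
    ring
  rw [hprod, he] at hcb
  simp only [eval_add, eval_mul, eval_pow, eval_C, eval_X, eval_sub, eval_comp] at hcb
  rw [show p / 2 * (p - p / 2) = p ^ 2 * ((4 : ℕ) : ℚ)⁻¹ by push_cast; ring] at hcb
  generalize eval (p ^ 2 * ((4 : ℕ) : ℚ)⁻¹) (R.map (Int.castRingHom ℚ)) = r at *
  have h4 : (4 : ℚ) ^ (2 * n) = 4 ^ n * 4 ^ n := by rw [two_mul, pow_add]
  rw [h4]
  apply mul_right_cancel₀ hW0
  field_simp
  push_cast at hcb ⊢
  linear_combination (-16 * 4 ^ 4) * hcb -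
    (4 ^ n) ^ 2 * (16 * 4 ^ 4 * c0 + 1280 * p * c1 + 256 * p ^ 2 * c2)

theorem morley_generalized (p : ℕ) (hp : p.Prime) (hodd : Odd p) :
    PModEq p (if p = 7 then 6 else 7)
      ((-1 : ℚ) ^ ((p - 1) / 2) * (Nat.choose (p - 1) ((p - 1) / 2) : ℚ))
      ((4 : ℚ) ^ (p - 1) *
        (1 - (5 / 16) * p * (∑ k ∈ Finset.Icc 1 (p - 1), (1 : ℚ) / k)
          + (1 / 16) * p ^ 2 *
            (∑ i ∈ Finset.Icc 1 (p - 1), ∑ j ∈ Finset.Icc (i + 1) (p - 1),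
              (1 : ℚ) / (i * j)))) := by
  obtain ⟨n, rfl⟩ := hodd
  have : Fact (2 * n + 1).Prime := ⟨hp⟩
  rw [Nat.add_sub_cancel, Nat.mul_div_cancel_left n two_pos, ← Nat.centralBinom_eq_two_mul_choose]
  obtain ⟨b, R, hb, h⟩ := centralBinom_sub_eq n
  have hdvd := dvd_coeff_three n hp
  rw [← hb] at hdvd
  unfold PModEq
  rw [h]
  apply isPInteger_of_mem
  set S := pIntegers (2 * n + 1)
  set p := 2 * n + 1
  have hp0 : (p : ℚ) ≠ 0 := by exact_mod_cast hp.ne_zero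
  have hpS : (p : ℚ) ∈ S := natCast_mem S p
  have hW : ((2 * n).factorial : ℚ)⁻¹ ∈ S :=
    inv_natCast_mem_pIntegers (hp.coprime_iff_not_dvd.2 (by rw [hp.dvd_factorial]; omega))
  have h4 : ((4 : ℕ) : ℚ)⁻¹ ∈ S := inv_natCast_mem_pIntegers
    ((Nat.coprime_primes hp Nat.prime_two).2 (by omega) |>.pow_right 2)
  have hR := eval_map_intCast_mem S R (mul_mem (pow_mem hpS 2) h4)
  generalize (R.map (Int.castRingHom ℚ)).eval ((p : ℚ) ^ 2 * ((4 : ℕ) : ℚ)⁻¹) = r at *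
  generalize ((2 * n).factorial : ℚ)⁻¹ = w at *
  generalize ((4 : ℕ) : ℚ)⁻¹ = q at *
  have h4n : (4 : ℚ) ^ (2 * n) ∈ S := pow_mem (ofNat_mem S 4) _
  split_ifs with h7
  · have : 4 ^ (2 * n) * w * (b * (p : ℚ) ^ 6 * q ^ 3 + p ^ 8 * q ^ 4 * r) / p ^ 6 =
        4 ^ (2 * n) * w * (b * q ^ 3 + p ^ 2 * q ^ 4 * r) := by
      field_simp
    rw [this]
    exact mul_mem (mul_mem h4n hW) (add_mem (mul_mem (intCast_mem S b) (pow_mem h4 3))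
      (mul_mem (mul_mem (pow_mem hpS 2) (pow_mem h4 4)) hR))
  · obtain ⟨c, rfl⟩ := hdvd (by omega)
    have : 4 ^ (2 * n) * w *
        (((p : ℤ) * c : ℤ) * (p : ℚ) ^ 6 * q ^ 3 + p ^ 8 * q ^ 4 * r) / p ^ 7 =
        4 ^ (2 * n) * w * (c * q ^ 3 + p * q ^ 4 * r) := by
      push_cast
      field_simp
    rw [this]
    exact mul_mem (mul_mem h4n hW) (add_mem (mul_mem (intCast_mem S c) (pow_mem h4 3))
      (mul_mem (mul_mem hpS (pow_mem h4 4)) hR))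
end

section
/- Let p ≥ 5 be a prime and let α be a p-integer. Then C(αp−1, p−1) ≡ 1 (mod p³). -/
open Finset

open Polynomial in
/-- Over `ZMod p`, the nonzero residues are exactly the roots of `X ^ (p - 1) - 1`. -/
theorem prod_Icc_X_sub_natCast_zmod (p : ℕ) [hp : Fact p.Prime] :
    ∏ k ∈ Finset.Icc 1 (p - 1), (X - (k : (ZMod p)[X])) = X ^ (p - 1) - 1 := by
  have hp1 : p - 1 ≠ 0 := by have := hp.out.two_le; omega
  have hcast : ∀ k ∈ Finset.Icc 1 (p - 1),
      (X - (k : (ZMod p)[X])) = X - C (k : ZMod p) := by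
    intro k _
    simp
  rw [Finset.prod_congr rfl hcast]
  have hmonic : (∏ k ∈ Finset.Icc 1 (p - 1), (X - C (k : ZMod p))).Monic :=
    monic_prod_X_sub_C _ _
  have hmonic' : (X ^ (p - 1) - 1 : (ZMod p)[X]).Monic := by
    simpa using monic_X_pow_sub_C (1 : ZMod p) hp1
  refine (eq_of_monic_of_dvd_of_natDegree_le hmonic hmonic' ?_ ?_).symm
  · refine Finset.prod_dvd_of_coprime (fun i hi j hj hij => ?_) fun k hk => ?_
    · refine isCoprime_X_sub_C_of_isUnit_sub (IsUnit.mk0 _ (sub_ne_zero.2 fun h => hij ?_))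
      simp only [Finset.coe_Icc, Set.mem_Icc] at hi hj
      rw [ZMod.natCast_eq_natCast_iff'] at h
      rwa [Nat.mod_eq_of_lt (by omega), Nat.mod_eq_of_lt (by omega)] at h
    · rw [Finset.mem_Icc] at hk
      have hk0 : (k : ZMod p) ≠ 0 := by
        rw [Ne, ZMod.natCast_eq_zero_iff]
        exact Nat.not_dvd_of_pos_of_lt (by omega) (by omega)
      rw [dvd_iff_isRoot]
      simp [ZMod.pow_card_sub_one_eq_one hk0]
  · rw [natDegree_finsetProd_X_sub_C_eq_card, ← C_1, natDegree_X_pow_sub_C]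
    simp

open Polynomial in
/-- The polynomial `∏ (X - k)`, `1 ≤ k ≤ p - 1`, in the form `(p-1)! + p²bX + pcX² + X³g`. -/
theorem prod_Icc_X_sub_natCast_expansion (p : ℕ) (hp : p.Prime) (hp5 : 5 ≤ p) :
    ∃ (b c : ℤ) (g : ℤ[X]), ∏ k ∈ Finset.Icc 1 (p - 1), (X - (k : ℤ[X])) =
      C ((p - 1).factorial : ℤ) + C ((p : ℤ) ^ 2 * b) * X + C ((p : ℤ) * c) * X ^ 2
        + X ^ 3 * g := by
  have : Fact p.Prime := ⟨hp⟩
  obtain ⟨f, hf⟩ : ∃ f : ℤ[X], f = ∏ k ∈ Finset.Icc 1 (p - 1), (X - (k : ℤ[X])) := ⟨_, rfl⟩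
  have hexp : f = C (f.coeff 0) + C (f.coeff 1) * X + C (f.coeff 2) * X ^ 2
      + X ^ 3 * f.divX.divX.divX := by
    have h0 := divX_mul_X_add f
    have h1 := divX_mul_X_add f.divX
    have h2 := divX_mul_X_add f.divX.divX
    simp only [coeff_divX, zero_add, Nat.reduceAdd] at h1 h2
    linear_combination -h0 - X * h1 - X ^ 2 * h2
  have hfact : ∏ k ∈ Finset.Icc 1 (p - 1), (k : ℤ) = (p - 1).factorial := by
    rw [← Finset.prod_Ico_id_eq_factorial, Nat.cast_prod]
    rfl
  have hcoeff0 : f.coeff 0 = (p - 1).factorial := by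
    rw [coeff_zero_eq_eval_zero, hf, eval_prod, ← hfact]
    have heven : Even (p - 1) := hp.even_sub_one (by omega)
    simp [Finset.prod_neg, heven.neg_one_pow]
  have hevalp : f.eval (p : ℤ) = (p - 1).factorial := by
    rw [hf, eval_prod, ← hfact]
    refine Finset.prod_nbij' (fun k => p - k) (fun k => p - k) ?_ ?_ ?_ ?_ ?_ <;>
      simp only [Finset.mem_Icc] <;> intro k hk
    · omega
    · omega
    · omega
    · omega
    · rw [Nat.cast_sub (by omega)]
      simp
  have hcoeff2 : (p : ℤ) ∣ f.coeff 2 := by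
    rw [← ZMod.intCast_zmod_eq_zero_iff_dvd]
    have hmap : f.map (Int.castRingHom (ZMod p)) = X ^ (p - 1) - 1 := by
      rw [← prod_Icc_X_sub_natCast_zmod, hf, Polynomial.map_prod]
      simp
    have h := congrArg (fun q => q.coeff 2) hmap
    have hne : 2 ≠ p - 1 := by omega
    simpa [coeff_X_pow, coeff_one, hne] using h
  obtain ⟨c, hc⟩ := hcoeff2
  have hcoeff1 : f.coeff 1 = (p : ℤ) ^ 2 * -(c + (f.divX.divX.divX).eval (p : ℤ)) := by
    have h := congrArg (eval (p : ℤ)) hexp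
    rw [hevalp, hcoeff0, hc] at h
    simp only [eval_add, eval_mul, eval_C, eval_X, eval_pow] at h
    have hp0 : (p : ℤ) ≠ 0 := by exact_mod_cast hp.ne_zero
    refine mul_left_cancel₀ hp0 ?_
    linear_combination -h
  refine ⟨-(c + (f.divX.divX.divX).eval (p : ℤ)), c, f.divX.divX.divX, ?_⟩
  rw [← hf, ← hcoeff0, ← hcoeff1, ← hc]
  exact hexp

theorem isPInteger_iff_norm_le_one (p : ℕ) [Fact p.Prime] (x : ℚ) :
    IsPInteger p x ↔ ‖(x : ℚ_[p])‖ ≤ 1 := by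
  rw [Padic.norm_le_one_iff_val_nonneg, Padic.valuation_ratCast, IsPInteger]

theorem glaisher_generalized_pIntegers (p : ℕ) (hp : p.Prime) (hp5 : 5 ≤ p)
    (α : ℚ) (hα : IsPInteger p α) :
    PModEq p 3 (genBinom p α) 1 := by
  have : Fact p.Prime := ⟨hp⟩
  obtain ⟨b, c, g, hf⟩ := prod_Icc_X_sub_natCast_expansion p hp hp5
  rw [isPInteger_iff_norm_le_one] at hα
  obtain ⟨a, ha⟩ : ∃ a : ℤ_[p], PadicInt.Coe.ringHom a = (α : ℚ_[p]) := ⟨⟨α, hα⟩, rfl⟩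
  have hnum := congrArg (Polynomial.aeval (a * p)) hf
  simp only [map_prod, map_sub, map_add, map_mul, map_pow, Polynomial.aeval_X, map_natCast,
    eq_intCast, map_intCast] at hnum
  have hnum' := congrArg (PadicInt.Coe.ringHom (p := p)) hnum
  simp only [map_prod, map_sub, map_add, map_mul, map_pow, map_natCast, map_intCast, ha] at hnum'
  have hunit : ‖((p - 1).factorial : ℚ_[p])‖ = 1 := by
    rw [Padic.norm_natCast_eq_one_iff]
    exact hp.coprime_factorial_of_lt (Nat.sub_lt hp.pos one_pos)
  have hfac0 : ((p - 1).factorial : ℚ_[p]) ≠ 0 := by exact_mod_cast (p - 1).factorial_ne_zero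
  have hp0 : (p : ℚ_[p]) ≠ 0 := by exact_mod_cast hp.ne_zero
  have hquot : (((genBinom p α - 1) / (p : ℚ) ^ 3 : ℚ) : ℚ_[p]) =
      PadicInt.Coe.ringHom (p := p)
        (b * a + c * a ^ 2 + a ^ 3 * Polynomial.aeval (a * p) g : ℤ_[p])
        / ((p - 1).factorial : ℚ_[p]) := by
    rw [genBinom]
    push_cast
    simp only [map_add, map_mul, map_pow, map_intCast, ha]
    rw [hnum']
    field_simp
    ring
  rw [PModEq, isPInteger_iff_norm_le_one, hquot, norm_div, hunit, div_one]
  exact PadicInt.norm_le_one (p := p) _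
end

section
/- Let p ≥ 7 be a prime and let α be a p-integer. Then C(αp−1, p−1) ≡ 1 − (1/2)·α(α−1)·p²·(∑_{k=1}^{p−1} 1/k²) (mod p⁵). -/
open Finset

theorem isPInteger_iff_exists_padicInt (p : ℕ) [Fact p.Prime] (q : ℚ) :
    IsPInteger p q ↔ ∃ z : ℤ_[p], (z : ℚ_[p]) = q := by
  have hp1 : (1 : ℚ) < p := by exact_mod_cast (Fact.out : p.Prime).one_lt
  have hnorm : IsPInteger p q ↔ ‖(q : ℚ_[p])‖ ≤ 1 := by
    rw [Padic.eq_padicNorm, IsPInteger]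
    rcases eq_or_ne q 0 with rfl | hq
    · simp
    · rw [padicNorm.eq_zpow_of_nonzero hq]
      norm_cast
      rw [zpow_le_one_iff_right₀ (by exact_mod_cast hp1)]
      omega
  rw [hnorm]
  exact ⟨fun h => ⟨⟨q, h⟩, rfl⟩, fun ⟨z, hz⟩ => hz ▸ z.2⟩

/-- Second-order expansion of `∏ (1 - y tᵢ)`, in terms of power sums. -/
theorem exists_two_mul_prod_one_sub_mul_eq {ι R : Type*} [CommRing R] (s : Finset ι) (t : ι → R)
    (y : R) :
    ∃ r, 2 * ∏ i ∈ s, (1 - y * t i) =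
      2 - 2 * y * ∑ i ∈ s, t i + y ^ 2 * ((∑ i ∈ s, t i) ^ 2 - ∑ i ∈ s, t i ^ 2) + y ^ 3 * r := by
  classical
  induction s using Finset.induction_on with
  | empty => exact ⟨0, by simp⟩
  | insert a s ha ih =>
    obtain ⟨r, hr⟩ := ih
    refine ⟨r * (1 - y * t a) - t a * ((∑ i ∈ s, t i) ^ 2 - ∑ i ∈ s, t i ^ 2), ?_⟩
    rw [Finset.prod_insert ha, Finset.sum_insert ha, Finset.sum_insert ha, mul_left_comm, hr]
    ring

@[to_additive]
theorem prod_Icc_even_eq_prod_mul_reflect {M : Type*} [CommMonoid M] (m : ℕ) (f : ℕ → M) :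
    ∏ k ∈ Icc 1 (2 * m), f k = ∏ k ∈ Icc 1 m, f k * f (2 * m + 1 - k) := by
  have hunion : Icc 1 (2 * m) = Icc 1 m ∪ Icc (m + 1) (2 * m) := by
    ext k; simp only [mem_union, mem_Icc]; omega
  have hdisj : Disjoint (Icc 1 m) (Icc (m + 1) (2 * m)) := by
    rw [Finset.disjoint_left]; intro k; simp only [mem_Icc]; omega
  rw [hunion, Finset.prod_union hdisj, Finset.prod_mul_distrib]
  congr 1
  refine Finset.prod_nbij' (fun k => 2 * m + 1 - k) (fun k => 2 * m + 1 - k) ?_ ?_ ?_ ?_ ?_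
  · intro k; simp only [mem_Icc]; omega
  · intro k; simp only [mem_Icc]; omega
  · intro k; simp only [mem_Icc]; omega
  · intro k; simp only [mem_Icc]; omega
  · intro k hk
    rw [mem_Icc] at hk
    congr 1; omega

theorem ZMod.sum_Icc_inv_pow_eq_zero (p : ℕ) [Fact p.Prime] (i : ℕ) (hi : 0 < i)
    (hip : i < p - 1) : ∑ k ∈ Icc 1 (p - 1), ((k : ZMod p)⁻¹) ^ i = 0 := by
  have hsum := FiniteField.sum_pow_lt_card_sub_one (K := ZMod p) (p - 1 - i)
    (by rw [ZMod.card]; omega)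
  rw [← Finset.sum_erase (f := fun x : ZMod p => x ^ (p - 1 - i)) (a := 0) _
    (zero_pow (by omega))] at hsum
  rw [← hsum]
  refine Finset.sum_nbij' (fun k => (k : ZMod p)) ZMod.val ?_ ?_ ?_ ?_ ?_
  · intro k hk
    rw [mem_Icc] at hk
    simp only [mem_erase, mem_univ, and_true, ne_eq, ZMod.natCast_eq_zero_iff]
    exact Nat.not_dvd_of_pos_of_lt (by omega) (by omega)
  · intro x hx
    have h0 : x.val ≠ 0 := by simpa using hx
    have := ZMod.val_lt x
    rw [mem_Icc]; omega
  · intro k hk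
    rw [mem_Icc] at hk
    exact ZMod.val_cast_of_lt (by omega)
  · intro x _
    exact ZMod.natCast_zmod_val x
  · intro k hk
    rw [mem_Icc] at hk
    have hk0 : (k : ZMod p) ≠ 0 := by
      rw [ne_eq, ZMod.natCast_eq_zero_iff]
      exact Nat.not_dvd_of_pos_of_lt (by omega) (by omega)
    rw [inv_pow]
    apply inv_eq_of_mul_eq_one_right
    rw [← pow_add, Nat.add_sub_cancel' hip.le]
    exact ZMod.pow_card_sub_one_eq_one hk0

theorem PadicInt.natCast_dvd_iff_toZMod_eq_zero {p : ℕ} [Fact p.Prime] (x : ℤ_[p]) :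
    (p : ℤ_[p]) ∣ x ↔ PadicInt.toZMod x = 0 := by
  rw [← RingHom.mem_ker, PadicInt.ker_toZMod, PadicInt.maximalIdeal_eq_span_p,
    Ideal.mem_span_singleton]

theorem PadicInt.exists_mul_natCast_eq_one {p : ℕ} [Fact p.Prime] {k : ℕ} (hk : k ∈ Icc 1 (p - 1)) :
    ∃ v : ℤ_[p], v * k = 1 := by
  rw [mem_Icc] at hk
  have : IsUnit (k : ℤ_[p]) := by
    rw [PadicInt.isUnit_iff, PadicInt.norm_natCast_eq_one_iff]
    exact Nat.coprime_of_lt_prime (by omega) (by omega) Fact.out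
  exact this.exists_left_inv

/-- The congruence in `ℤ_[p]`, where `u k` plays the role of `1 / k`. -/
theorem PadicInt.pow_five_dvd_prod_sub {p : ℕ} [Fact p.Prime] (hp7 : 7 ≤ p) (a : ℤ_[p])
    (u : ℕ → ℤ_[p]) (hu : ∀ k ∈ Icc 1 (p - 1), u k * k = 1) :
    (p : ℤ_[p]) ^ 5 ∣ ∏ k ∈ Icc 1 (p - 1), (a * p * u k - 1) -
      (1 - u 2 * a * (a - 1) * p ^ 2 * ∑ k ∈ Icc 1 (p - 1), u k ^ 2) := by
  obtain ⟨m, hm⟩ : ∃ m, p = 2 * m + 1 :=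
    (Fact.out : p.Prime).odd_of_ne_two (by omega)
  have hpm : p - 1 = 2 * m := by omega
  have hu2 : u 2 * 2 = 1 := by exact_mod_cast hu 2 (by rw [mem_Icc]; omega)
  set t : ℕ → ℤ_[p] := fun k => u k * u (p - k) with ht
  have hcast : ∀ k ∈ Icc 1 (p - 1), ((p - k : ℕ) : ℤ_[p]) = p - k := fun k hk => by
    rw [mem_Icc] at hk
    exact Nat.cast_sub (by omega)
  have hurefl : ∀ k ∈ Icc 1 (p - 1), u (p - k) * (p - k) = 1 := fun k hk => by
    rw [← hcast k hk]
    apply hu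
    rw [mem_Icc] at hk ⊢
    omega
  have hadd : ∀ k ∈ Icc 1 (p - 1), u k + u (p - k) = p * t k := fun k hk => by
    linear_combination (-u (p - k)) * hu k hk - u k * hurefl k hk
  have hmem : ∀ k ∈ Icc 1 m, k ∈ Icc 1 (p - 1) := fun k hk => by
    rw [mem_Icc] at hk ⊢
    omega
  have hprod : ∏ k ∈ Icc 1 (p - 1), (a * p * u k - 1) =
      ∏ k ∈ Icc 1 m, (1 - a * (1 - a) * p ^ 2 * t k) := by
    rw [hpm, prod_Icc_even_eq_prod_mul_reflect, ← hm]
    refine Finset.prod_congr rfl fun k hk => ?_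
    linear_combination (-a * p) * hadd k (hmem k hk)
  have hsum : ∑ k ∈ Icc 1 (p - 1), u k ^ 2 =
      p ^ 2 * ∑ k ∈ Icc 1 m, t k ^ 2 - 2 * ∑ k ∈ Icc 1 m, t k := by
    rw [hpm, sum_Icc_even_eq_sum_add_reflect, ← hm, Finset.mul_sum, Finset.mul_sum,
      ← Finset.sum_sub_distrib]
    refine Finset.sum_congr rfl fun k hk => ?_
    linear_combination (u k + u (p - k) + p * t k) * hadd k (hmem k hk)
  have hφu : ∀ k ∈ Icc 1 (p - 1), PadicInt.toZMod (u k) = (k : ZMod p)⁻¹ := fun k hk => by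
    apply eq_inv_of_mul_eq_one_left
    rw [← map_natCast (PadicInt.toZMod (p := p)) k, ← map_mul, hu k hk, map_one]
  have hφrefl : ∀ k ∈ Icc 1 (p - 1), PadicInt.toZMod (u (p - k)) = -(k : ZMod p)⁻¹ := fun k hk => by
    have h := congrArg (PadicInt.toZMod (p := p)) (hadd k hk)
    rw [map_add, map_mul, map_natCast, ZMod.natCast_self, zero_mul, hφu k hk] at h
    linear_combination h
  have hdvd2 : (p : ℤ_[p]) ∣ ∑ k ∈ Icc 1 (p - 1), u k ^ 2 := by
    rw [PadicInt.natCast_dvd_iff_toZMod_eq_zero, map_sum,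
      ← ZMod.sum_Icc_inv_pow_eq_zero p 2 (by omega) (by omega)]
    exact Finset.sum_congr rfl fun k hk => by rw [map_pow, hφu k hk]
  have hdvd4 : (p : ℤ_[p]) ∣ ∑ k ∈ Icc 1 (p - 1), t k ^ 2 := by
    rw [PadicInt.natCast_dvd_iff_toZMod_eq_zero, map_sum,
      ← ZMod.sum_Icc_inv_pow_eq_zero p 4 (by omega) (by omega)]
    refine Finset.sum_congr rfl fun k hk => ?_
    rw [map_pow, map_mul, hφu k hk, hφrefl k hk]
    ring
  have htsum : ∑ k ∈ Icc 1 (p - 1), t k ^ 2 = 2 * ∑ k ∈ Icc 1 m, t k ^ 2 := by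
    rw [hpm, sum_Icc_even_eq_sum_add_reflect, ← hm, Finset.mul_sum]
    refine Finset.sum_congr rfl fun k hk => ?_
    have hk' : p - (p - k) = k := by
      rw [mem_Icc] at hk
      omega
    simp only [ht, hk']
    ring
  obtain ⟨r, hr⟩ := exists_two_mul_prod_one_sub_mul_eq (Icc 1 m) t (a * (1 - a) * p ^ 2)
  obtain ⟨v, hv⟩ := hdvd4
  obtain ⟨w, hw⟩ := hdvd2
  rw [htsum] at hv
  rw [← hprod] at hr
  rw [hw] at hsum ⊢
  generalize ∏ k ∈ Icc 1 (p - 1), (a * p * u k - 1) = F at *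
  generalize ∑ k ∈ Icc 1 m, t k ^ 2 = T₂ at *
  generalize ∑ k ∈ Icc 1 m, t k = T₁ at *
  have hT₂ : T₂ = p * (u 2 * v) := by linear_combination u 2 * hv - T₂ * hu2
  obtain ⟨A, hT₁⟩ : ∃ A, T₁ = p * A :=
    ⟨u 2 * (p ^ 2 * (u 2 * v) - w), by
      rw [hT₂] at hsum
      linear_combination u 2 * hsum - T₁ * hu2⟩
  subst hT₂ hT₁
  refine ⟨u 2 * (-(a * (1 - a) * (u 2 * v)) + (a * (1 - a)) ^ 2 * (p * A ^ 2 - u 2 * v) +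
    (a * (1 - a)) ^ 3 * p * r), ?_⟩
  linear_combination u 2 * hr - (F - 1) * hu2 - u 2 * (a * (1 - a) * p ^ 2) * hsum

theorem genBinom_harmonic2_mod_p5 (p : ℕ) (hp : p.Prime) (hp7 : 7 ≤ p)
    (α : ℚ) (hα : IsPInteger p α) :
    PModEq p 5 (genBinom p α)
      (1 - (1 / 2) * α * (α - 1) * p ^ 2 * (∑ k ∈ Finset.Icc 1 (p - 1), (1 : ℚ) / (k ^ 2))) := by
  have : Fact p.Prime := ⟨hp⟩
  obtain ⟨a, ha⟩ := (isPInteger_iff_exists_padicInt p α).1 hα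
  choose! u hu using fun k (hk : k ∈ Icc 1 (p - 1)) =>
    PadicInt.exists_mul_natCast_eq_one (p := p) hk
  obtain ⟨z, hz⟩ := PadicInt.pow_five_dvd_prod_sub hp7 a u hu
  have hcoe : ∀ k ∈ Icc 1 (p - 1), (u k : ℚ_[p]) = (k : ℚ_[p])⁻¹ := fun k hk => by
    apply eq_inv_of_mul_eq_one_left
    exact_mod_cast congrArg (fun x : ℤ_[p] => (x : ℚ_[p])) (hu k hk)
  have hcoe2 : (u 2 : ℚ_[p]) = 1 / 2 := by
    rw [hcoe 2 (by rw [mem_Icc]; omega)]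
    norm_num
  have hprod : ((genBinom p α : ℚ) : ℚ_[p]) =
      ((∏ k ∈ Icc 1 (p - 1), (a * p * u k - 1) : ℤ_[p]) : ℚ_[p]) := by
    rw [genBinom, ← Finset.prod_Ico_id_eq_factorial, Finset.Ico_add_one_right_eq_Icc,
      Nat.cast_prod, ← Finset.prod_div_distrib, Rat.cast_prod]
    refine Eq.trans (Finset.prod_congr rfl fun k hk => ?_)
      (map_prod PadicInt.Coe.ringHom _ _).symm
    change _ = ((a * p * u k - 1 : ℤ_[p]) : ℚ_[p])
    have hk0 : (k : ℚ_[p]) ≠ 0 := by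
      rw [mem_Icc] at hk
      exact_mod_cast (by omega : k ≠ 0)
    push_cast
    rw [ha, hcoe k hk]
    field_simp
  have hsum : ((∑ k ∈ Icc 1 (p - 1), (1 : ℚ) / (k ^ 2) : ℚ) : ℚ_[p]) =
      ((∑ k ∈ Icc 1 (p - 1), u k ^ 2 : ℤ_[p]) : ℚ_[p]) := by
    rw [Rat.cast_sum, PadicInt.coe_sum]
    refine Finset.sum_congr rfl fun k hk => ?_
    push_cast
    rw [hcoe k hk, inv_pow, one_div]
  have hp0 : (p : ℚ_[p]) ^ 5 ≠ 0 := pow_ne_zero _ (by exact_mod_cast hp.ne_zero)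
  refine (isPInteger_iff_exists_padicInt p _).2 ⟨z, ?_⟩
  have hz' := congrArg (fun x : ℤ_[p] => (x : ℚ_[p])) hz
  simp only [PadicInt.coe_sub, PadicInt.coe_mul, PadicInt.coe_pow, PadicInt.coe_one,
    PadicInt.coe_natCast, ← hprod, ← hsum, hcoe2, ha] at hz'
  rw [Rat.cast_div, eq_div_iff (by exact_mod_cast hp0)]
  simp only [Rat.cast_sub, Rat.cast_mul, Rat.cast_pow, Rat.cast_one, Rat.cast_natCast,
    Rat.cast_div, Rat.cast_ofNat]
  linear_combination -hz'
end

section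
/- Let p ≥ 11 be a prime and let α be a p-integer. Then C(αp−1, p−1) ≡ 1 + α(α−1)·p·(∑_{k=1}^{p−1} 1/k) + (1/6)·α²(α−1)²·p³·(∑_{k=1}^{p−1} 1/k³) (mod p⁶). -/
open Finset

/-- A product over `1, …, 2h` is a product over the pairs `{k, 2h + 1 - k}`. -/
@[to_additive]
theorem prod_Icc_eq_prod_pairs {M : Type*} [CommMonoid M] (f : ℕ → M) (h : ℕ) :
    ∏ k ∈ Icc 1 (2 * h), f k = ∏ k ∈ Icc 1 h, f k * f (2 * h + 1 - k) := by
  have hsplit := Finset.prod_Ico_consecutive f (m := 1) (n := h + 1) (k := 2 * h + 1)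
    (by omega) (by omega)
  rw [← Ico_add_one_right_eq_Icc, ← Ico_add_one_right_eq_Icc, ← hsplit, prod_mul_distrib]
  congr 1
  refine Finset.prod_nbij' (fun k => 2 * h + 1 - k) (fun k => 2 * h + 1 - k) ?_ ?_ ?_ ?_ ?_ <;>
    simp only [mem_Ico] <;> intro k hk
  · omega
  · omega
  · omega
  · omega
  · congr 1; omega

/-- Expansion of `∏ (1 + y a_i)` up to a remainder divisible by `y ^ 3`. -/
theorem exists_prod_one_add_mul_eq {K ι : Type*} [Field K] [NeZero (2 : K)] (A : Subring K)
    (h2 : (2 : K)⁻¹ ∈ A) {y : K} (hy : y ∈ A) (s : Finset ι) (a : ι → K)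
    (ha : ∀ i ∈ s, a i ∈ A) :
    ∃ r ∈ A, ∏ i ∈ s, (1 + y * a i) =
      1 + y * ∑ i ∈ s, a i + y ^ 2 * (2⁻¹ * ((∑ i ∈ s, a i) ^ 2 - ∑ i ∈ s, a i ^ 2))
        + y ^ 3 * r := by
  classical
  induction s using Finset.induction_on with
  | empty => exact ⟨0, A.zero_mem, by simp⟩
  | insert i s hi ih =>
    obtain ⟨r, hr, hprod⟩ := ih fun j hj => ha j (mem_insert_of_mem hj)
    have hai := ha i (mem_insert_self i s)
    have hs : ∀ j ∈ s, a j ∈ A := fun j hj => ha j (mem_insert_of_mem hj)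
    refine ⟨r + a i * (2⁻¹ * ((∑ i ∈ s, a i) ^ 2 - ∑ i ∈ s, a i ^ 2)) + y * a i * r,
      A.add_mem (A.add_mem hr (A.mul_mem hai (A.mul_mem h2 (A.sub_mem (pow_mem (sum_mem hs) 2)
        (sum_mem fun j hj => pow_mem (hs j hj) 2))))) (A.mul_mem (A.mul_mem hy hai) hr), ?_⟩
    have h2' : (2 : K) ≠ 0 := NeZero.ne 2
    rw [prod_insert hi, sum_insert hi, sum_insert hi, hprod]
    field_simp
    ring

theorem mem_pIntegers {p : ℕ} [Fact p.Prime] {x : ℚ} :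
    x ∈ pIntegers p ↔ ‖(x : ℚ_[p])‖ ≤ 1 := Iff.rfl

theorem isPInteger_iff_mem_pIntegers {p : ℕ} [Fact p.Prime] {x : ℚ} :
    IsPInteger p x ↔ x ∈ pIntegers p := by
  rw [mem_pIntegers, Padic.norm_le_one_iff_val_nonneg, Padic.valuation_ratCast, IsPInteger]

theorem natCast_inv_mem_pIntegers {p : ℕ} [Fact p.Prime] {n : ℕ} (hn : ¬ p ∣ n) :
    (n : ℚ)⁻¹ ∈ pIntegers p := by
  have : ‖((n : ℤ_[p]) : ℚ_[p])‖ = 1 := PadicInt.norm_natCast_eq_one_iff.mpr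
    ((Fact.out : p.Prime).coprime_iff_not_dvd.mpr hn)
  rw [mem_pIntegers]
  push_cast at this ⊢
  rw [norm_inv, this, inv_one]

theorem ZMod.sum_Icc_natCast (p : ℕ) [Fact p.Prime] {M : Type*} [AddCommMonoid M]
    (g : ZMod p → M) (hg : g 0 = 0) :
    ∑ k ∈ Icc 1 (p - 1), g k = ∑ x : ZMod p, g x := by
  have hp : 0 < p := (Fact.out : p.Prime).pos
  rw [← Finset.sum_erase univ hg]
  refine Finset.sum_bij' (fun k _ => (k : ZMod p)) (fun x _ => x.val) ?_ ?_ ?_ ?_ ?_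
  · intro k hk
    rw [mem_Icc] at hk
    simp only [mem_erase, mem_univ, and_true, ne_eq, ZMod.natCast_eq_zero_iff]
    exact Nat.not_dvd_of_pos_of_lt hk.1 (by omega)
  · intro x hx
    have h0 : x.val ≠ 0 := by simpa [ZMod.val_eq_zero] using hx
    have := x.val_lt
    simp only [mem_Icc]
    omega
  · intro k hk
    rw [mem_Icc] at hk
    exact ZMod.val_cast_of_lt (by omega)
  · intro x _
    exact ZMod.natCast_zmod_val x
  · intros; rfl

/-- The inverse squares modulo `p ≥ 5` sum to zero. -/
theorem ZMod.sum_Icc_inv_sq_eq_zero (p : ℕ) [Fact p.Prime] (hp : 5 ≤ p) :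
    ∑ k ∈ Icc 1 (p - 1), ((k : ZMod p)⁻¹) ^ 2 = 0 := by
  rw [ZMod.sum_Icc_natCast p (fun x => (x⁻¹) ^ 2) (by simp),
    inv_involutive.bijective.sum_comp (fun x : ZMod p => x ^ 2)]
  exact FiniteField.sum_pow_lt_card_sub_one (ZMod p) 2 (by rw [ZMod.card]; omega)

/-- For a prime `p = 2h + 1 ≥ 5`, the sum of `1 / (k (p - k))` over `k ≤ h` is divisible by `p`
in the ring of `p`-integers. -/
theorem sum_inv_mul_sub_div_mem_pIntegers {p h : ℕ} [Fact p.Prime] (hp : 5 ≤ p)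
    (hh : p = 2 * h + 1) :
    (∑ k ∈ Icc 1 h, ((k : ℚ) * (p - k))⁻¹) / p ∈ pIntegers p := by
  have hprime : p.Prime := Fact.out
  let z (k : ℕ) : ℤ_[p] := PadicInt.inv ((k * (p - k) : ℕ) : ℤ_[p])
  have hnorm {k : ℕ} (hk : k ∈ Icc 1 (2 * h)) : ‖((k * (p - k) : ℕ) : ℤ_[p])‖ = 1 := by
    rw [mem_Icc] at hk
    rw [PadicInt.norm_natCast_eq_one_iff, hprime.coprime_iff_not_dvd, hprime.dvd_mul, not_or]
    exact ⟨Nat.not_dvd_of_pos_of_lt (by omega) (by omega),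
      Nat.not_dvd_of_pos_of_lt (by omega) (by omega)⟩
  have hz_mul {k : ℕ} (hk : k ∈ Icc 1 (2 * h)) : z k * ((k * (p - k) : ℕ) : ℤ_[p]) = 1 :=
    PadicInt.inv_mul (hnorm hk)
  have hz {k : ℕ} (hk : k ∈ Icc 1 (2 * h)) : (z k : ℚ_[p]) = ((k : ℚ_[p]) * (p - k))⁻¹ := by
    have hmul := congrArg ((↑) : ℤ_[p] → ℚ_[p]) (hz_mul hk)
    rw [mem_Icc] at hk
    rw [PadicInt.coe_mul, PadicInt.coe_natCast, PadicInt.coe_one, Nat.cast_mul,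
      Nat.cast_sub (by omega)] at hmul
    exact eq_inv_of_mul_eq_one_left hmul
  have hzmod {k : ℕ} (hk : k ∈ Icc 1 (2 * h)) :
      PadicInt.toZMod (z k) = -((k : ZMod p)⁻¹) ^ 2 := by
    have hmul := congrArg (PadicInt.toZMod (p := p)) (hz_mul hk)
    rw [mem_Icc] at hk
    rw [map_mul, map_natCast, map_one, Nat.cast_mul, Nat.cast_sub (by omega),
      ZMod.natCast_self] at hmul
    rw [eq_inv_of_mul_eq_one_left hmul, zero_sub, mul_neg, inv_neg, mul_inv, sq]
  have hfull : ∑ k ∈ Icc 1 (2 * h), PadicInt.toZMod (z k) = 0 := by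
    rw [sum_congr rfl fun k hk => hzmod hk, sum_neg_distrib, show 2 * h = p - 1 by omega,
      ZMod.sum_Icc_inv_sq_eq_zero p hp, neg_zero]
  have hhalf : PadicInt.toZMod (∑ k ∈ Icc 1 h, z k) = 0 := by
    rw [sum_Icc_eq_sum_pairs, sum_congr rfl (g := fun k => 2 * PadicInt.toZMod (z k)),
      ← mul_sum, ← map_sum] at hfull
    · refine (mul_eq_zero.mp hfull).resolve_left fun h2 => ?_
      have : p ∣ 2 := (ZMod.natCast_eq_zero_iff 2 p).mp (by exact_mod_cast h2)
      exact absurd (Nat.le_of_dvd two_pos this) (by omega)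
    · intro k hk
      rw [mem_Icc] at hk
      have : z (2 * h + 1 - k) = z k := by
        simp only [z]
        rw [← hh, Nat.sub_sub_self (by omega), mul_comm]
      rw [this, two_mul]
  rw [← RingHom.mem_ker, PadicInt.ker_toZMod, PadicInt.maximalIdeal_eq_span_p,
    Ideal.mem_span_singleton] at hhalf
  obtain ⟨c, hc⟩ := hhalf
  have hc' := congrArg ((↑) : ℤ_[p] → ℚ_[p]) hc
  have hp0 : (p : ℚ_[p]) ≠ 0 := Nat.cast_ne_zero.mpr hprime.ne_zero
  rw [PadicInt.coe_sum, PadicInt.coe_mul, PadicInt.coe_natCast,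
    sum_congr rfl fun k hk => hz (Icc_subset_Icc_right (by omega) hk)] at hc'
  rw [mem_pIntegers]
  push_cast
  rw [hc', mul_div_cancel_left₀ _ hp0]
  exact c.norm_le_one

/-- Pairing the factors `k` and `p - k` of the generalized binomial coefficient. -/
theorem genBinom_eq_prod_pairs {p h : ℕ} (hh : p = 2 * h + 1) (α : ℚ) :
    genBinom p α =
      ∏ k ∈ Icc 1 h, (1 + α * (α - 1) * p ^ 2 * ((k : ℚ) * (p - k))⁻¹) := by
  have hfact : (Nat.factorial (p - 1) : ℚ) = ∏ k ∈ Icc 1 (p - 1), (k : ℚ) := by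
    rw [← Finset.prod_Ico_id_eq_factorial, Nat.cast_prod, Ico_add_one_right_eq_Icc]
  rw [genBinom, hfact, ← prod_div_distrib, show p - 1 = 2 * h by omega,
    prod_Icc_eq_prod_pairs]
  refine prod_congr rfl fun k hk => ?_
  rw [mem_Icc] at hk
  have hk0 : (k : ℚ) ≠ 0 := by simp; omega
  have hpk : (p : ℚ) - k ≠ 0 := by
    rw [sub_ne_zero, Nat.cast_injective.ne_iff]; omega
  rw [← hh, Nat.cast_sub (by omega)]
  field_simp
  ring

theorem genBinom_harmonic3_mod_p6 (p : ℕ) (hp : p.Prime) (hp11 : 11 ≤ p)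
    (α : ℚ) (hα : IsPInteger p α) :
    PModEq p 6 (genBinom p α)
      (1 + α * (α - 1) * p * (∑ k ∈ Finset.Icc 1 (p - 1), (1 : ℚ) / k)
        + (1 / 6) * α ^ 2 * (α - 1) ^ 2 * p ^ 3 *
          (∑ k ∈ Finset.Icc 1 (p - 1), (1 : ℚ) / (k ^ 3))) := by
  have : Fact p.Prime := ⟨hp⟩
  obtain ⟨h, hh⟩ : ∃ h, p = 2 * h + 1 := hp.odd_of_ne_two (by omega)
  rw [isPInteger_iff_mem_pIntegers] at hα
  have hp0 : (p : ℚ) ≠ 0 := Nat.cast_ne_zero.mpr hp.ne_zero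
  have hndvd {n : ℕ} (h0 : 0 < n) (hn : n < p) : ¬ p ∣ n := Nat.not_dvd_of_pos_of_lt h0 hn
  have h2 : (2 : ℚ)⁻¹ ∈ pIntegers p := by
    exact_mod_cast natCast_inv_mem_pIntegers (hndvd two_pos (by omega))
  have h6 : (6 : ℚ)⁻¹ ∈ pIntegers p := by
    exact_mod_cast natCast_inv_mem_pIntegers (n := 6) (hndvd (by omega) (by omega))
  set a : ℕ → ℚ := fun k => ((k : ℚ) * (p - k))⁻¹ with ha_def
  have ha : ∀ k ∈ Icc 1 h, a k ∈ pIntegers p := by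
    intro k hk
    rw [mem_Icc] at hk
    simp only [ha_def]
    rw [mul_inv, ← Nat.cast_sub (by omega)]
    exact mul_mem (natCast_inv_mem_pIntegers (hndvd (by omega) (by omega)))
      (natCast_inv_mem_pIntegers (hndvd (by omega) (by omega)))
  have hβ : α * (α - 1) ∈ pIntegers p := mul_mem hα (sub_mem hα (one_mem _))
  have hpairs : ∀ k ∈ Icc 1 h, (k : ℚ) ≠ 0 ∧ (p : ℚ) - k ≠ 0 ∧
      ((2 * h + 1 - k : ℕ) : ℚ) = p - k := by
    intro k hk
    rw [mem_Icc] at hk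
    refine ⟨by simp; omega, ?_, ?_⟩
    · rw [sub_ne_zero, Nat.cast_injective.ne_iff]; omega
    · rw [← hh, Nat.cast_sub (by omega)]
  have hH1 : ∑ k ∈ Icc 1 (p - 1), (1 : ℚ) / k = p * ∑ k ∈ Icc 1 h, a k := by
    rw [show p - 1 = 2 * h by omega, sum_Icc_eq_sum_pairs, mul_sum]
    refine sum_congr rfl fun k hk => ?_
    obtain ⟨hk0, hpk, hcast⟩ := hpairs k hk
    simp only [hcast, ha_def]
    field_simp
    ring
  have hH3 : ∑ k ∈ Icc 1 (p - 1), (1 : ℚ) / (k ^ 3) =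
      p ^ 3 * ∑ k ∈ Icc 1 h, a k ^ 3 - 3 * p * ∑ k ∈ Icc 1 h, a k ^ 2 := by
    rw [show p - 1 = 2 * h by omega, sum_Icc_eq_sum_pairs, mul_sum, mul_sum,
      ← sum_sub_distrib]
    refine sum_congr rfl fun k hk => ?_
    obtain ⟨hk0, hpk, hcast⟩ := hpairs k hk
    simp only [hcast, ha_def]
    field_simp
    ring
  obtain ⟨r, hr, hprod⟩ := exists_prod_one_add_mul_eq (pIntegers p) h2
    (mul_mem hβ (pow_mem (natCast_mem _ p) 2)) (Icc 1 h) a ha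
  obtain ⟨c, hc, hS⟩ : ∃ c ∈ pIntegers p, ∑ k ∈ Icc 1 h, a k = p * c :=
    ⟨_, sum_inv_mul_sub_div_mem_pIntegers (by omega) hh, (mul_div_cancel₀ _ hp0).symm⟩
  rw [PModEq, isPInteger_iff_mem_pIntegers, genBinom_eq_prod_pairs hh, hprod, hH1, hH3, hS]
  have hmem : (α * (α - 1)) ^ 2 * c ^ 2 * 2⁻¹ + (α * (α - 1)) ^ 3 * r
      - (α * (α - 1)) ^ 2 * 6⁻¹ * ∑ k ∈ Icc 1 h, a k ^ 3 ∈ pIntegers p :=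
    sub_mem (add_mem (mul_mem (mul_mem (pow_mem hβ 2) (pow_mem hc 2)) h2)
      (mul_mem (pow_mem hβ 3) hr))
      (mul_mem (mul_mem (pow_mem hβ 2) h6) (sum_mem fun k hk => pow_mem (ha k hk) 3))
  convert hmem using 1
  rw [div_eq_iff (pow_ne_zero 6 hp0)]
  ring
end

section
/- Let p be an odd prime and let m ≥ 1 be an integer. Then H_{2m−1} − m·p·H_{2m} = (1/2)·p²·∑_{k=2m+1}^{p−1} (−1)^k·C(k, 2m−1)·p^{k−2m−1}·H_k, as an identity of rational numbers (where C(k, 2m−1) is an ordinary binomial coefficient). -/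
open Finset

/-- `H p m` : the `m`-th elementary symmetric function of `1/1, 1/2, …, 1/(p-1)`.
By convention `H p 0 = 1` and `H p m = 0` for `m ≥ p`. -/
def H (p m : ℕ) : ℚ :=
  ∑ t ∈ (Finset.Icc 1 (p - 1)).powersetCard m, ∏ k ∈ t, (1 : ℚ) / k

open Polynomial in
theorem prod_one_add_C_mul_X_eq_sum_H {p : ℕ} (hp : 0 < p) :
    ∏ k ∈ Icc 1 (p - 1), (1 + C ((1 : ℚ) / k) * X) = ∑ j ∈ range p, C (H p j) * X ^ j := by
  rw [prod_one_add, sum_powerset, Nat.card_Icc, show p - 1 + 1 - 1 + 1 = p by omega]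
  refine sum_congr rfl fun j _ => ?_
  rw [H, map_sum, sum_mul]
  refine sum_congr rfl fun t ht => ?_
  rw [prod_mul_distrib, prod_const, (mem_powersetCard.mp ht).2, map_prod]

theorem H_eq_zero_of_le {p n : ℕ} (hp : 0 < p) (h : p ≤ n) : H p n = 0 := by
  rw [H, powersetCard_eq_empty.mpr (by rw [Nat.card_Icc]; omega), sum_empty]

open Polynomial in
theorem prod_one_add_C_mul_X_comp_neg_add {p : ℕ} (hodd : Odd p) :
    (∏ k ∈ Icc 1 (p - 1), (1 + C ((1 : ℚ) / k) * X)).comp (-(X + C (p : ℚ))) =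
      ∏ k ∈ Icc 1 (p - 1), (1 + C ((1 : ℚ) / k) * X) := by
  have factor (k : ℕ) (hk : k ∈ Icc 1 (p - 1)) :
      (1 + C ((1 : ℚ) / k) * X : ℚ[X]) = C ((1 : ℚ) / k) * (C (k : ℚ) + X) := by
    have hk0 : (k : ℚ) ≠ 0 := by
      have := (mem_Icc.mp hk).1
      positivity
    rw [mul_add, ← C_mul, one_div_mul_cancel hk0, C_1]
  have reflect : ∏ k ∈ Icc 1 (p - 1), (C ((p - k : ℕ) : ℚ) + X : ℚ[X]) =
      ∏ k ∈ Icc 1 (p - 1), (C (k : ℚ) + X) := by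
    refine prod_nbij' (fun k => p - k) (fun k => p - k) ?_ ?_ ?_ ?_ ?_ <;> intro k hk <;>
      simp only [mem_Icc] at * <;> omega
  have even_card : Even (Icc 1 (p - 1)).card := by
    rw [Nat.card_Icc, Nat.add_sub_cancel]
    exact Nat.Odd.sub_odd hodd odd_one
  rw [prod_congr rfl factor, prod_mul_distrib, mul_comp, ← map_prod C, C_comp]
  congr 1
  calc (∏ k ∈ Icc 1 (p - 1), (C (k : ℚ) + X)).comp (-(X + C (p : ℚ)))
      = ∏ k ∈ Icc 1 (p - 1), (-1) * (C (k : ℚ) + X) := by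
        rw [← reflect, Polynomial.prod_comp]
        refine prod_congr rfl fun k hk => ?_
        rw [Nat.cast_sub (by have := mem_Icc.mp hk; omega)]
        simp only [add_comp, sub_comp, C_comp, X_comp, C_sub]
        ring
    _ = ∏ k ∈ Icc 1 (p - 1), (C (k : ℚ) + X) := by
        rw [prod_mul_distrib, prod_const, even_card.neg_one_pow, one_mul]

open Polynomial in
theorem H_eq_sum_range {p : ℕ} (hodd : Odd p) (n N : ℕ) (hN : p ≤ N) :
    H p n = ∑ j ∈ range N, (-1 : ℚ) ^ j * (j.choose n : ℚ) * (p : ℚ) ^ (j - n) * H p j := by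
  have key := congrArg (fun P => coeff P n) (prod_one_add_C_mul_X_comp_neg_add hodd)
  simp only [prod_one_add_C_mul_X_eq_sum_H hodd.pos, Polynomial.sum_comp, mul_comp, C_comp, pow_comp,
    X_comp, finsetSum_coeff, coeff_C_mul, coeff_X_pow, neg_pow (X + C (p : ℚ))] at key
  have sign (j : ℕ) : ((-1) ^ j : ℚ[X]) = C ((-1) ^ j) := by simp
  simp only [sign, coeff_C_mul, coeff_X_add_C_pow] at key
  rw [← sum_subset (range_subset_range.mpr hN)]
  · trans ∑ j ∈ range p, H p j * if n = j then 1 else 0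
    · simp only [mul_ite, mul_one, mul_zero, sum_ite_eq, mem_range]
      split_ifs with h
      · rfl
      · exact H_eq_zero_of_le hodd.pos (not_lt.mp h)
    · rw [← key]
      exact sum_congr rfl fun j _ => by ring
  · intro j _ hj
    rw [H_eq_zero_of_le hodd.pos (by simpa using hj), mul_zero]

theorem H_reflection_identity (p : ℕ) (hp : p.Prime) (hodd : Odd p)
    (m : ℕ) (hm : 1 ≤ m) :
    H p (2 * m - 1) - m * p * H p (2 * m) =
      (1 / 2) * p ^ 2 *
        ∑ k ∈ Finset.Icc (2 * m + 1) (p - 1),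
          (-1 : ℚ) ^ k * (Nat.choose k (2 * m - 1) : ℚ) * (p : ℚ) ^ (k - 2 * m - 1) * H p k := by
  obtain ⟨m, rfl⟩ := Nat.exists_eq_add_of_le' hm
  have key := H_eq_sum_range hodd (2 * m + 1) (2 * m + 3 + p) (by omega)
  have low : ∑ j ∈ range (2 * m + 1),
      (-1 : ℚ) ^ j * (j.choose (2 * m + 1) : ℚ) * (p : ℚ) ^ (j - (2 * m + 1)) * H p j = 0 :=
    sum_eq_zero fun j hj => by
      rw [Nat.choose_eq_zero_of_lt (mem_range.mp hj)]
      simp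
  rw [← sum_range_add_sum_Ico _ (Nat.le_add_right (2 * m + 3) p), sum_range_succ, sum_range_succ,
    low, Nat.choose_self, Nat.choose_succ_self_right, Nat.sub_self,
    show 2 * m + 1 + 1 - (2 * m + 1) = 1 by omega,
    show (-1 : ℚ) ^ (2 * m + 1) = -1 from Odd.neg_one_pow ⟨m, rfl⟩,
    show (-1 : ℚ) ^ (2 * m + 1 + 1) = 1 from Even.neg_one_pow ⟨m + 1, by ring⟩] at key
  have tail : ∑ j ∈ Ico (2 * m + 3) (2 * m + 3 + p),
      (-1 : ℚ) ^ j * (j.choose (2 * m + 1) : ℚ) * (p : ℚ) ^ (j - (2 * m + 1)) * H p j =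
      p ^ 2 * ∑ k ∈ Icc (2 * m + 3) (p - 1),
        (-1 : ℚ) ^ k * (k.choose (2 * m + 1) : ℚ) * (p : ℚ) ^ (k - (2 * m + 2) - 1) * H p k := by
    have hpos := hp.pos
    rw [mul_sum, ← sum_subset (s₁ := Icc (2 * m + 3) (p - 1))]
    · refine sum_congr rfl fun k hk => ?_
      have := mem_Icc.mp hk
      rw [show k - (2 * m + 1) = k - (2 * m + 2) - 1 + 2 by omega, pow_add]
      ring
    · intro k hk
      simp only [mem_Icc, mem_Ico] at *
      omega
    · intro k hk hk'
      simp only [mem_Icc, mem_Ico] at *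
      rw [H_eq_zero_of_le hpos (by omega), mul_zero]
  rw [tail] at key
  simp only [show 2 * (m + 1) = 2 * m + 2 by ring, show 2 * m + 2 - 1 = 2 * m + 1 by omega,
    show 2 * m + 2 + 1 = 2 * m + 3 by ring] at key ⊢
  push_cast at key ⊢
  linear_combination key / 2
end

section
/- Let p be an odd prime and let m be an integer with 1 ≤ m and m ≠ p−1. Then H_m ≡ 0 (mod p), i.e., the p-adic valuation of H_m is at least 1 (this is trivially true for m ≥ p, where H_m = 0). -/
open Finset

/-- The elementary symmetric functions of all elements of `ZMod p` vanish, except in degrees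
`0` and `p - 1`. -/
theorem esymm_univ_zmod_eq_zero (p : ℕ) [Fact p.Prime] {m : ℕ} (hm : 1 ≤ m) (hm' : m ≠ p - 1) :
    (Finset.univ : Finset (ZMod p)).val.esymm m = 0 := by
  have hp1 : 1 < p := (Fact.out : p.Prime).one_lt
  rcases lt_or_ge p m with hlt | hle
  · rw [Multiset.esymm, Multiset.powersetCard_eq_empty _ (by simpa [ZMod.card] using hlt)]
    simp
  have hroots : (Polynomial.X ^ p - Polynomial.X : Polynomial (ZMod p)).roots
      = Finset.univ.val := by
    simpa [ZMod.card] using FiniteField.roots_X_pow_card_sub_X (ZMod p)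
  have hdeg : (Polynomial.X ^ p - Polynomial.X : Polynomial (ZMod p)).natDegree = p :=
    FiniteField.X_pow_card_sub_X_natDegree_eq (ZMod p) hp1
  have hcard : Multiset.card (Polynomial.X ^ p - Polynomial.X : Polynomial (ZMod p)).roots
      = (Polynomial.X ^ p - Polynomial.X : Polynomial (ZMod p)).natDegree := by
    rw [hroots, hdeg]; simp [ZMod.card]
  have hlead : (Polynomial.X ^ p - Polynomial.X : Polynomial (ZMod p)).leadingCoeff = 1 := by
    rw [Polynomial.leadingCoeff, hdeg]
    simp [Polynomial.coeff_X, hp1.ne]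
  have h := Polynomial.coeff_eq_esymm_roots_of_card hcard (k := p - m) (by omega)
  rw [hdeg, hroots, hlead, Nat.sub_sub_self hle, Polynomial.coeff_sub, Polynomial.coeff_X_pow,
    Polynomial.coeff_X, if_neg (by omega), if_neg (by omega)] at h
  simpa using h.symm

/-- The elementary symmetric functions of the nonzero elements of `ZMod p` vanish, except in
degrees `0` and `p - 1`. -/
theorem esymm_nonzero_zmod_eq_zero (p : ℕ) [Fact p.Prime] {m : ℕ} (hm : 1 ≤ m)
    (hm' : m ≠ p - 1) :
    (Finset.univ.erase (0 : ZMod p)).val.esymm m = 0 := by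
  have h := esymm_univ_zmod_eq_zero p hm hm'
  obtain ⟨n, rfl⟩ : ∃ n, m = n + 1 := ⟨m - 1, by omega⟩
  rw [← Finset.insert_erase (Finset.mem_univ (0 : ZMod p)),
    Finset.insert_val_of_notMem (Finset.notMem_erase _ _), Multiset.esymm,
    Multiset.powersetCard_cons] at h
  simpa [Multiset.esymm] using h

/-- The residues of `(p - 1)! / k`, for `1 ≤ k ≤ p - 1`, run over the nonzero elements of
`ZMod p`. -/
theorem map_factorial_div_val (p : ℕ) [Fact p.Prime] :
    (Finset.Icc 1 (p - 1)).val.map (fun k => (((p - 1).factorial / k : ℕ) : ZMod p))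
      = (Finset.univ.erase (0 : ZMod p)).val := by
  have hp : p.Prime := Fact.out
  have hD : ((p - 1).factorial : ZMod p) ≠ 0 := by simp [ZMod.wilsons_lemma]
  have hmul : ∀ k ∈ Finset.Icc 1 (p - 1),
      (((p - 1).factorial / k : ℕ) : ZMod p) * k = (p - 1).factorial := by
    intro k hk
    rw [Finset.mem_Icc] at hk
    rw [← Nat.cast_mul, Nat.div_mul_cancel (Nat.dvd_factorial hk.1 hk.2)]
  have hne : ∀ k ∈ Finset.Icc 1 (p - 1), (((p - 1).factorial / k : ℕ) : ZMod p) ≠ 0 :=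
    fun k hk h0 => hD (by rw [← hmul k hk, h0, zero_mul])
  have hinj : Set.InjOn (fun k => (((p - 1).factorial / k : ℕ) : ZMod p))
      (Finset.Icc 1 (p - 1)) := by
    intro a ha b hb hab
    have hab' : (a : ZMod p) = b := by
      apply mul_left_cancel₀ (hne a ha)
      rw [hmul a ha, show (((p - 1).factorial / a : ℕ) : ZMod p) = _ from hab, hmul b hb]
    have hmod := (ZMod.natCast_eq_natCast_iff _ _ _).1 hab'
    simp only [Finset.coe_Icc, Set.mem_Icc] at ha hb
    exact hmod.eq_of_lt_of_lt (by omega) (by omega)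
  rw [← Finset.image_val_of_injOn hinj, Finset.val_inj]
  apply Finset.eq_of_subset_of_card_le
  · intro x hx
    obtain ⟨k, hk, rfl⟩ := Finset.mem_image.1 hx
    exact Finset.mem_erase.2 ⟨hne k hk, Finset.mem_univ _⟩
  · rw [Finset.card_image_of_injOn hinj, Finset.card_erase_of_mem (Finset.mem_univ _)]
    simp [ZMod.card]

/-- `H p m` written over the common denominator `(p - 1)! ^ m`. -/
theorem H_eq_div (p m : ℕ) :
    H p m = ((∑ t ∈ (Finset.Icc 1 (p - 1)).powersetCard m,
      ∏ k ∈ t, (p - 1).factorial / k : ℕ) : ℚ) / ((p - 1).factorial : ℚ) ^ m := by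
  rw [H, Nat.cast_sum, Finset.sum_div]
  refine Finset.sum_congr rfl fun t ht => ?_
  obtain ⟨hsub, hcard⟩ := Finset.mem_powersetCard.1 ht
  rw [Nat.cast_prod, ← hcard, ← Finset.prod_const, ← Finset.prod_div_distrib]
  refine Finset.prod_congr rfl fun k hk => ?_
  have hk' := Finset.mem_Icc.1 (hsub hk)
  have hk0 : (k : ℚ) ≠ 0 := by exact_mod_cast (by omega : k ≠ 0)
  have hD : ((p - 1).factorial : ℚ) ≠ 0 := by exact_mod_cast Nat.factorial_ne_zero _
  rw [Nat.cast_div (Nat.dvd_factorial hk'.1 hk'.2) hk0]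
  field_simp

theorem H_mod_p (p : ℕ) (hp : p.Prime) (hodd : Odd p)
    (m : ℕ) (hm : 1 ≤ m) (hm' : m ≠ p - 1) :
    PModEq p 1 (H p m) 0 := by
  have : Fact p.Prime := ⟨hp⟩
  have hdvd : p ∣ ∑ t ∈ (Finset.Icc 1 (p - 1)).powersetCard m,
      ∏ k ∈ t, (p - 1).factorial / k := by
    rw [← ZMod.natCast_eq_zero_iff, ← esymm_nonzero_zmod_eq_zero p hm hm',
      ← map_factorial_div_val, Finset.esymm_map_val]
    push_cast
    rfl
  obtain ⟨c, hc⟩ := hdvd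
  have hp0 : (p : ℚ) ≠ 0 := by exact_mod_cast hp.ne_zero
  have hH : (H p m - 0) / (p : ℚ) ^ 1 = (c : ℚ) / (((p - 1).factorial ^ m : ℕ) : ℚ) := by
    rw [H_eq_div, hc]
    push_cast
    field_simp
    simp
  have hD : ¬ p ∣ (p - 1).factorial ^ m := fun h => by
    have := (hp.dvd_factorial).1 (hp.dvd_of_dvd_pow h)
    have := hp.pos
    omega
  rw [PModEq, IsPInteger, hH]
  rcases eq_or_ne c 0 with rfl | hc0
  · simp
  rw [padicValRat.div (by exact_mod_cast hc0)
    (by exact_mod_cast pow_ne_zero m (Nat.factorial_ne_zero _)), padicValRat.of_nat,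
    padicValRat.of_nat, padicValNat.eq_zero_of_not_dvd hD]
  simp
end

section
/- Let p be an odd prime and let m ≥ 1 be an odd integer with m ≠ p−2. Then H_m ≡ 0 (mod p²), i.e., the p-adic valuation of H_m is at least 2. -/
open Finset

open Polynomial in
/-- The polynomial `(X + 1)(X + 2)⋯(X + (p - 1))`. -/
noncomputable def risingPoly (p : ℕ) : ℤ[X] := ∏ k ∈ Icc 1 (p - 1), (X + C (k : ℤ))

open Polynomial in
theorem map_risingPoly_zmod (p : ℕ) [Fact p.Prime] :
    (risingPoly p).map (Int.castRingHom (ZMod p)) = X ^ (p - 1) - 1 := by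
  have hp : 1 < p := (Fact.out : p.Prime).one_lt
  have hmap : (risingPoly p).map (Int.castRingHom (ZMod p)) =
      ∏ k ∈ Icc 1 (p - 1), (X + C (k : ZMod p)) := by
    simp [risingPoly, Polynomial.map_prod]
  have hdeg : (∏ k ∈ Icc 1 (p - 1), (X + C (k : ZMod p))).degree = ((p - 1 : ℕ) : WithBot ℕ) := by
    simp only [degree_prod, degree_X_add_C, sum_const, Nat.card_Icc]
    simp
  have hmonic : (∏ k ∈ Icc 1 (p - 1), (X + C (k : ZMod p))).Monic :=
    monic_prod_of_monic _ _ fun k _ => monic_X_add_C _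
  have hdeg' : (X ^ (p - 1) - 1 : (ZMod p)[X]).degree = ((p - 1 : ℕ) : WithBot ℕ) :=
    degree_X_pow_sub_C (by omega) 1
  have hne {k : ℕ} (hk : k ∈ Icc 1 (p - 1)) : (k : ZMod p) ≠ 0 := by
    rw [mem_Icc] at hk
    rw [Ne, ZMod.natCast_eq_zero_iff]
    exact Nat.not_dvd_of_pos_of_lt hk.1 (by omega)
  rw [hmap]
  refine eq_of_degree_sub_lt_of_eval_index_eq (Icc 1 (p - 1)) (v := fun k : ℕ => -(k : ZMod p))
    ?_ ?_ ?_
  · intro a ha b hb hab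
    simp only [coe_Icc, Set.mem_Icc] at ha hb
    have h : (a : ZMod p) = b := neg_injective hab
    rw [ZMod.natCast_eq_natCast_iff] at h
    exact h.eq_of_lt_of_lt (by omega) (by omega)
  · have hlt := degree_sub_lt_left (hdeg.trans hdeg'.symm) hmonic.ne_zero
      (hmonic.leadingCoeff.trans (leadingCoeff_X_pow_sub_C (by omega) (r := (1 : ZMod p))).symm)
    rwa [Nat.card_Icc, Nat.add_sub_cancel, ← hdeg]
  · intro k hk
    have h0 : eval (-(k : ZMod p)) (∏ j ∈ Icc 1 (p - 1), (X + C (j : ZMod p))) = 0 := by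
      rw [eval_prod]
      exact prod_eq_zero hk (by simp)
    rw [h0]
    simp [ZMod.pow_card_sub_one_eq_one (neg_ne_zero.2 (hne hk))]

open Polynomial in
theorem dvd_coeff_risingPoly {p : ℕ} [Fact p.Prime] {j : ℕ} (hj : j ≠ 0) (hj' : j ≠ p - 1) :
    (p : ℤ) ∣ (risingPoly p).coeff j := by
  rw [← ZMod.intCast_zmod_eq_zero_iff_dvd]
  have h := congrArg (fun f => coeff f j) (map_risingPoly_zmod p)
  simpa [coeff_X_pow, coeff_one, hj, hj'] using h

open Polynomial in
theorem taylor_neg_risingPoly {p : ℕ} (hodd : Odd p) :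
    taylor (-(p : ℤ)) (risingPoly p) = (risingPoly p).comp (-X) := by
  have hcard : (-1 : ℤ[X]) ^ #(Icc 1 (p - 1)) = 1 := by
    rw [Nat.card_Icc, Nat.add_sub_cancel]
    exact (Nat.Odd.sub_odd hodd odd_one).neg_one_pow
  have hreflect : (risingPoly p).comp (-X) = ∏ k ∈ Icc 1 (p - 1), (X - C (k : ℤ)) := by
    rw [← one_mul (∏ k ∈ Icc 1 (p - 1), (X - C (k : ℤ))), ← hcard, ← prod_const,
      ← prod_mul_distrib, risingPoly, Polynomial.prod_comp]
    refine prod_congr rfl fun k _ => ?_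
    simp only [add_comp, X_comp, C_comp]
    ring
  rw [hreflect, taylor_apply, risingPoly, Polynomial.prod_comp]
  refine prod_nbij' (fun k => p - k) (fun k => p - k) ?_ ?_ ?_ ?_ ?_
  · intro k hk; simp only [mem_Icc] at *; omega
  · intro k hk; simp only [mem_Icc] at *; omega
  · intro k hk; simp only [mem_Icc] at *; omega
  · intro k hk; simp only [mem_Icc] at *; omega
  · intro k hk
    rw [mem_Icc] at hk
    rw [Nat.cast_sub (by omega : k ≤ p)]
    simp only [add_comp, X_comp, C_comp, C_sub, C_neg]
    ring

open Polynomial in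
theorem sq_dvd_coeff_risingPoly {p : ℕ} [Fact p.Prime] (hodd : Odd p) {m : ℕ} (hmodd : Odd m)
    (hm : m ≠ p - 2) : (p : ℤ) ^ 2 ∣ (risingPoly p).coeff m := by
  set f := risingPoly p with hf
  have hsymm : (hasseDeriv m f).eval (-(p : ℤ)) = -f.coeff m := by
    rw [← taylor_coeff, taylor_neg_risingPoly hodd, ← neg_one_mul (X : ℤ[X]), ← C_1, ← C_neg,
      comp_C_mul_X_coeff, hmodd.neg_one_pow, mul_neg_one]
  obtain ⟨c, hc⟩ := binomExpansion (hasseDeriv m f) 0 (-(p : ℤ))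
  have h0 : (hasseDeriv m f).eval 0 = f.coeff m := by
    rw [← coeff_zero_eq_eval_zero, hasseDeriv_coeff]
    simp
  have h1 : (derivative (hasseDeriv m f)).eval 0 = (m + 1) * f.coeff (m + 1) := by
    rw [← coeff_zero_eq_eval_zero, coeff_derivative, hasseDeriv_coeff]
    simp [add_comm 1 m]
  have hm1 : m + 1 ≠ p - 1 := by
    have := (Fact.out : p.Prime).two_le
    omega
  obtain ⟨d, hd⟩ := dvd_coeff_risingPoly (p := p) m.succ_ne_zero hm1
  rw [Nat.succ_eq_add_one, ← hf] at hd
  rw [zero_add, hsymm, h0, h1, hd] at hc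
  have hcop : IsCoprime ((p : ℤ) ^ 2) 2 := by
    have := Nat.Coprime.pow_left 2 (Nat.coprime_two_right.2 hodd)
    exact_mod_cast Nat.isCoprime_iff_coprime.2 this
  refine hcop.dvd_of_dvd_mul_left ⟨(m + 1) * d - c, ?_⟩
  linear_combination -hc

open Polynomial in
theorem factorial_mul_H (p m : ℕ) : ((p - 1).factorial : ℚ) * H p m = (risingPoly p).coeff m := by
  have hfac : ((p - 1).factorial : ℚ) = ∏ k ∈ Icc 1 (p - 1), (k : ℚ) := by
    rw [← prod_Ico_id_eq_factorial, Nat.cast_prod, ← Ico_add_one_right_eq_Icc]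
  rw [risingPoly, prod_add, finsetSum_coeff, H, hfac, mul_sum, powersetCard_eq_filter,
    sum_filter, Int.cast_sum]
  refine sum_congr rfl fun t ht => ?_
  rw [prod_const, ← map_prod, mul_comm (X ^ _), coeff_C_mul, coeff_X_pow]
  by_cases h : #t = m
  · rw [if_pos h, if_pos h.symm, mul_one, ← prod_sdiff (mem_powerset.1 ht), mul_assoc,
      ← prod_mul_distrib]
    rw [prod_eq_one (s := t), mul_one]
    · push_cast
      rfl
    · intro k hk
      have := (mem_Icc.1 (mem_powerset.1 ht hk)).1
      exact mul_one_div_cancel (by positivity)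
  · rw [if_neg h, if_neg (Ne.symm h)]
    simp

theorem H_odd_mod_p_sq (p : ℕ) (hp : p.Prime) (hodd : Odd p)
    (m : ℕ) (hm : 1 ≤ m) (hmodd : Odd m) (hm' : m ≠ p - 2) :
    PModEq p 2 (H p m) 0 := by
  have := Fact.mk hp
  obtain ⟨d, hd⟩ := sq_dvd_coeff_risingPoly hodd hmodd hm'
  have hfac : ((p - 1).factorial : ℚ) ≠ 0 := by positivity
  have hp0 : (p : ℚ) ≠ 0 := by exact_mod_cast hp.ne_zero
  have hH := factorial_mul_H p m
  rw [hd] at hH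
  push_cast at hH
  have hquot : (H p m - 0) / (p : ℚ) ^ 2 = (d : ℚ) / ((p - 1).factorial : ℕ) := by
    rw [sub_zero, div_eq_div_iff (pow_ne_zero 2 hp0) hfac]
    linear_combination hH
  rw [PModEq, IsPInteger, hquot]
  rcases eq_or_ne d 0 with rfl | hd0
  · simp
  have hndvd : ¬ p ∣ (p - 1).factorial := by
    rw [hp.dvd_factorial]
    have := hp.pos
    omega
  rw [padicValRat.div (by exact_mod_cast hd0) hfac, padicValRat.of_int, padicValRat.of_nat,
    padicValNat.eq_zero_of_not_dvd hndvd]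
  simp
end
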